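/- arXiv:2604.25051 — 6 statements merged into one kernel-verified Lean document; each statement's English description precedes it below -/
import Mathlib

section
/- Let h ≥ 1 be an integer, let a'/b' < a/b be consecutive h-Farey fractions, and let 1 ≤ i ≤ h. Then the open interval (ia'/b', ia/b) contains no integer; equivalently, ⌈ia/b⌉ − 1 = ⌊ia'/b'⌋ = ia/b + φᵢ − 1 = ia'/b' − φ'ᵢ. -/
open scoped Classical

/-- `a/b` is an `h`-Farey fraction: a reduced fraction with `1 ≤ b ≤ h`. -/
def IsFareyFrac (h : ℕ) (a b : ℤ) : Prop :=
  0 < b ∧ b ≤ (h : ℤ) ∧ IsCoprime a b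

/-- `a'/b'` is the `h`-Farey predecessor of `a/b`: both are `h`-Farey
fractions, `a'/b' < a/b`, and no `h`-Farey fraction lies strictly between
them (so they are consecutive `h`-Farey fractions). -/
def IsFareyPred (h : ℕ) (a b a' b' : ℤ) : Prop :=
  IsFareyFrac h a b ∧ IsFareyFrac h a' b' ∧
    (a' : ℚ) / (b' : ℚ) < (a : ℚ) / (b : ℚ) ∧
    ∀ p q : ℤ, IsFareyFrac h p q →
      (p : ℚ) / (q : ℚ) ≤ (a' : ℚ) / (b' : ℚ) ∨ (a : ℚ) / (b : ℚ) ≤ (p : ℚ) / (q : ℚ)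

namespace Eliahou

/-- An element `x` of `S` is primitive if it is a nonzero element of `S` that is
not the sum of two smaller nonzero elements of `S`. -/
def IsPrimitive (S : Set ℤ) (x : ℤ) : Prop :=
  x ∈ S ∧ x ≠ 0 ∧
    ¬ ∃ u v : ℤ, u ∈ S ∧ v ∈ S ∧ u ≠ 0 ∧ v ≠ 0 ∧ u < x ∧ v < x ∧ u + v = x

/-- The numerical semigroup `⟨m, Γ⟩_c`: the additive submonoid generated by `m`,
the elements of `Γ` and all integers `≥ c`. -/
def SgpSet (m : ℤ) (Γ : Finset ℤ) (c : ℤ) : Set ℤ :=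
  (AddSubmonoid.closure ({m} ∪ (Γ : Set ℤ) ∪ Set.Ici c) : Set ℤ)

/-- `k`, the rank: the number of elements of `S` smaller than `c`. -/
noncomputable def rank (S : Set ℤ) (c : ℤ) : ℕ := (S ∩ Set.Iio c).ncard

/-- `ℓ`, the number of left generators: primitive elements smaller than `c`. -/
noncomputable def nLeftGen (S : Set ℤ) (c : ℤ) : ℕ :=
  {x : ℤ | IsPrimitive S x ∧ x < c}.ncard

/-- `r`, the number of right generators: primitive elements in `[c, c+m)`. -/
noncomputable def nRightGen (S : Set ℤ) (c m : ℤ) : ℕ :=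
  {x : ℤ | IsPrimitive S x ∧ c ≤ x ∧ x < c + m}.ncard

/-- `q = ⌈c/m⌉`, the depth. -/
noncomputable def qdepth (c m : ℤ) : ℤ := ⌈(c : ℚ) / (m : ℚ)⌉

/-- `ρ = qm − c`. -/
noncomputable def rho (c m : ℤ) : ℤ := qdepth c m * m - c

/-- The Eliahou number `E = kℓ + qr − c`. -/
noncomputable def EliahouNum (S : Set ℤ) (c m : ℤ) : ℤ :=
  (rank S c : ℤ) * (nLeftGen S c : ℤ) + qdepth c m * (nRightGen S c m : ℤ) - c

/-- The Wilf number `W = k(ℓ + r) − c`. -/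
noncomputable def WilfNum (S : Set ℤ) (c m : ℤ) : ℤ :=
  (rank S c : ℤ) * ((nLeftGen S c : ℤ) + (nRightGen S c m : ℤ)) - c

/-- The `i`-fold sumset `iΓ` of a finite set `Γ` (with `0Γ = {0}`). -/
def sumset (Γ : Finset ℤ) : ℕ → Set ℤ
  | 0 => {0}
  | i + 1 => {x : ℤ | ∃ g ∈ Γ, ∃ y ∈ sumset Γ i, x = g + y}

/-- `S` is collision-free: every element of `S` in `[c, c+m)` can be written in a
unique way (up to reordering, i.e. as a multiset) as a sum of generators
(primitive elements) of `S`. -/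
def IsCollisionFree (S : Set ℤ) (c m : ℤ) : Prop :=
  ∀ x ∈ S, c ≤ x → x < c + m →
    ∀ M N : Multiset ℤ,
      (∀ g ∈ M, IsPrimitive S g) → (∀ g ∈ N, IsPrimitive S g) →
      M.sum = x → N.sum = x → M = N

/-- `Δ` is a `B_h` set: sums of `h` elements of `Δ` with repetition allowed are
pairwise distinct up to permutation. -/
def IsBhSet (h : ℕ) (Δ : Finset ℕ) : Prop :=
  ∀ M N : Multiset ℕ, (∀ x ∈ M, x ∈ Δ) → (∀ x ∈ N, x ∈ Δ) →
    Multiset.card M = h → Multiset.card N = h → M.sum = N.sum → M = N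

/-! ### The construction `S(h, a/b, Δ, τ, m)` -/

/-- The conductor `c = ⌊ahm/b⌋ − m − τ` of `S(h, a/b, Δ, τ, m)`. -/
noncomputable def Sc (h : ℕ) (a b τ m : ℤ) : ℤ :=
  ⌊(a : ℚ) * (h : ℚ) * (m : ℚ) / (b : ℚ)⌋ - m - τ

/-- The base point `⌊(c + m − 1)/h⌋`. -/
noncomputable def Sbase (h : ℕ) (a b τ m : ℤ) : ℤ :=
  ⌊((Sc h a b τ m + m - 1 : ℤ) : ℚ) / (h : ℚ)⌋

/-- `δ₁ = max Δ`. -/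
def delta1 (Δ : Finset ℕ) : ℕ := Δ.sup id

/-- The set of left generators `Γ = ⌊(c + m − 1)/h⌋ − Δ` (elementwise). -/
noncomputable def Sgam (h : ℕ) (a b τ m : ℤ) (Δ : Finset ℕ) : Finset ℤ :=
  Δ.image fun δ => Sbase h a b τ m - (δ : ℤ)

/-- The semigroup `S(h, a/b, Δ, τ, m) = ⟨m, Γ⟩_c`. -/
noncomputable def Sset (h : ℕ) (a b τ m : ℤ) (Δ : Finset ℕ) : Set ℤ :=
  SgpSet m (Sgam h a b τ m Δ) (Sc h a b τ m)

/-- `t = ahm/b − c − m`. -/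
noncomputable def St (h : ℕ) (a b τ m : ℤ) : ℚ :=
  (a : ℚ) * (h : ℚ) * (m : ℚ) / (b : ℚ) - ((Sc h a b τ m : ℤ) : ℚ) - (m : ℚ)

/-- `γ₁ = min Γ = ⌊(c + m − 1)/h⌋ − δ₁`. -/
noncomputable def gamma1 (h : ℕ) (a b τ m : ℤ) (Δ : Finset ℕ) : ℤ :=
  Sbase h a b τ m - (delta1 Δ : ℤ)

/-- `w = c + m − hγ₁`. -/
noncomputable def Sw (h : ℕ) (a b τ m : ℤ) (Δ : Finset ℕ) : ℤ :=
  Sc h a b τ m + m - (h : ℤ) * gamma1 h a b τ m Δ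

/-- `⌊(h − i) a'/b'⌋`, the lower bound for the number of left elements
determined by `λ ∈ iΓ`. -/
noncomputable def shortBound (h : ℕ) (a' b' : ℤ) (i : ℕ) : ℤ :=
  ⌊((h : ℚ) - (i : ℚ)) * (a' : ℚ) / (b' : ℚ)⌋

/-- `⌈(c − λ)/m⌉`. -/
noncomputable def ceilCount (c m lam : ℤ) : ℤ := ⌈((c - lam : ℤ) : ℚ) / (m : ℚ)⌉

/-- `S(h, a/b, Δ, τ, m)` is short: every `λ ∈ iΓ` with `i < h` satisfies
`⌈(c − λ)/m⌉ = ⌊(h − i) a'/b'⌋`. -/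
def IsShort (h : ℕ) (a b a' b' τ m : ℤ) (Δ : Finset ℕ) : Prop :=
  ∀ i < h, ∀ lam ∈ sumset (Sgam h a b τ m Δ) i,
    ceilCount (Sc h a b τ m) m lam = shortBound h a' b' i

/-- `ω`, the number of long elements (elements `λ ∈ iΓ`, `i < h`, with
`⌈(c − λ)/m⌉ = ⌊(h − i) a'/b'⌋ + 1`). -/
noncomputable def nLong (h : ℕ) (a b a' b' τ m : ℤ) (Δ : Finset ℕ) : ℕ :=
  ∑ i ∈ Finset.range h,
    {lam ∈ sumset (Sgam h a b τ m Δ) i |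
      ceilCount (Sc h a b τ m) m lam = shortBound h a' b' i + 1}.ncard

/-- The interval `U_i`: `U_0 = {0}` and `U_i = [iγ₁, i(c+m)/h)` for `i ≥ 1`;
here `cm` stands for `c + m`. -/
noncomputable def Uset (h : ℕ) (cm γ₁ : ℤ) (i : ℕ) : Set ℤ :=
  if i = 0 then {0}
  else {x : ℤ | (i : ℤ) * γ₁ ≤ x ∧ (x : ℚ) < (i : ℚ) * (cm : ℚ) / (h : ℚ)}

/-- `S(h, a/b, Δ, τ, m)` is split: the intervals `U_i`, `0 ≤ i ≤ h`, are
pairwise disjoint modulo `m`. -/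
def IsSplit (h : ℕ) (a b τ m : ℤ) (Δ : Finset ℕ) : Prop :=
  ∀ i ≤ h, ∀ j ≤ h, i ≠ j →
    ∀ x ∈ Uset h (Sc h a b τ m + m) (gamma1 h a b τ m Δ) i,
      ∀ y ∈ Uset h (Sc h a b τ m + m) (gamma1 h a b τ m Δ) j, ¬ m ∣ x - y

/-- `S(h, a/b, Δ, τ, m)` is canonically defined: `m` and all elements of `Γ`
are primitive in `S` and `c − 1 ∉ S`. -/
def IsCanonical (h : ℕ) (a b τ m : ℤ) (Δ : Finset ℕ) : Prop :=
  IsPrimitive (Sset h a b τ m Δ) m ∧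
    (∀ g ∈ Sgam h a b τ m Δ, IsPrimitive (Sset h a b τ m Δ) g) ∧
    Sc h a b τ m - 1 ∉ Sset h a b τ m Δ

/-- `φ_i = frac(−ia/b)`. -/
noncomputable def phi (a b : ℤ) (i : ℕ) : ℚ :=
  Int.fract (-((i : ℚ) * (a : ℚ)) / (b : ℚ))

/-- `φ'_i = frac(ia'/b')`. -/
noncomputable def phi' (a' b' : ℤ) (i : ℕ) : ℚ :=
  Int.fract ((i : ℚ) * (a' : ℚ) / (b' : ℚ))

/-- `s_i = C(ℓ + i − 2, i)`, the number of multisets of size `i` from `ℓ − 1`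
elements. -/
def svec (l i : ℕ) : ℕ := (l + i - 2).choose i

/-- `E₀ = −ℓ Σ_{i=0}^{h−1} φ'_{h−i} s_i + φ'_h s`. -/
noncomputable def E0 (h : ℕ) (a' b' : ℤ) (l : ℕ) : ℚ :=
  -(l : ℚ) * ∑ i ∈ Finset.range h, phi' a' b' (h - i) * (svec l i : ℚ)
    + phi' a' b' h * ((l + h - 1).choose h : ℚ)

/-- `τ̂ = ⌊(h − b)(hδ₁ + 1)/b⌋`. -/
noncomputable def tauhat (h : ℕ) (b : ℤ) (Δ : Finset ℕ) : ℤ :=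
  ⌊((h : ℚ) - (b : ℚ)) * ((h : ℚ) * (delta1 Δ : ℚ) + 1) / (b : ℚ)⌋

/-- `m̂ = ((b + b')h − bb')δ₁ + b + b'`. -/
def mhat (h : ℕ) (b b' : ℤ) (Δ : Finset ℕ) : ℤ :=
  ((b + b') * (h : ℤ) - b * b') * (delta1 Δ : ℤ) + b + b'

/-- A collision: a pair of distinct multisets of at most `h` elements of `Γ`
whose sums agree modulo `m`. -/
def IsCollision (Γ : Finset ℤ) (m : ℤ) (h : ℕ) (M N : Multiset ℤ) : Prop :=
  (∀ x ∈ M, x ∈ Γ) ∧ (∀ x ∈ N, x ∈ Γ) ∧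
    Multiset.card M ≤ h ∧ Multiset.card N ≤ h ∧ M ≠ N ∧ m ∣ M.sum - N.sum

/-- A primitive collision: a collision at `λ = M.sum` such that one cannot
write `λ = μ + ν` with `ν` a nonempty sum of elements of `Γ` and a smaller
collision occurring at `μ`. -/
def IsPrimitiveCollision (Γ : Finset ℤ) (m : ℤ) (h : ℕ) (M N : Multiset ℤ) : Prop :=
  IsCollision Γ m h M N ∧
    ¬ ∃ (P M' N' : Multiset ℤ), (∀ x ∈ P, x ∈ Γ) ∧ P ≠ 0 ∧
        IsCollision Γ m h M' N' ∧ M.sum = M'.sum + P.sum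

end Eliahou

open Eliahou

/-- If `a'/b' < a/b` are consecutive `h`-Farey fractions and
`1 ≤ i ≤ h`, then the open interval `(ia'/b', ia/b)` contains no integer;
equivalently `⌈ia/b⌉ − 1 = ⌊ia'/b'⌋ = ia/b + φ_i − 1 = ia'/b' − φ'_i`. -/
theorem farey_interval_no_integer (h : ℕ) (hh : 1 ≤ h) (a b a' b' : ℤ)
    (hF : IsFareyPred h a b a' b') (i : ℕ) (hi1 : 1 ≤ i) (hih : i ≤ h) :
    (∀ n : ℤ, ¬ ((i : ℚ) * (a' : ℚ) / (b' : ℚ) < (n : ℚ) ∧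
        (n : ℚ) < (i : ℚ) * (a : ℚ) / (b : ℚ))) ∧
    ⌈(i : ℚ) * (a : ℚ) / (b : ℚ)⌉ - 1 = ⌊(i : ℚ) * (a' : ℚ) / (b' : ℚ)⌋ ∧
    ((⌊(i : ℚ) * (a' : ℚ) / (b' : ℚ)⌋ : ℚ)
      = (i : ℚ) * (a : ℚ) / (b : ℚ) + phi a b i - 1) ∧
    ((⌊(i : ℚ) * (a' : ℚ) / (b' : ℚ)⌋ : ℚ)
      = (i : ℚ) * (a' : ℚ) / (b' : ℚ) - phi' a' b' i) := by
  obtain ⟨hab, hab', hlt, hcons⟩ := hF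
  have hi : (0 : ℚ) < (i : ℚ) := by exact_mod_cast hi1
  have hno : ∀ n : ℤ, ¬ ((i : ℚ) * (a' : ℚ) / (b' : ℚ) < (n : ℚ) ∧
        (n : ℚ) < (i : ℚ) * (a : ℚ) / (b : ℚ)) := by
    rintro n ⟨h1, h2⟩
    rw [mul_div_assoc] at h1 h2
    have h1' : (a' : ℚ) / (b' : ℚ) < (n : ℚ) / (i : ℚ) := by
      rw [lt_div_iff₀ hi]; linarith
    have h2' : (n : ℚ) / (i : ℚ) < (a : ℚ) / (b : ℚ) := by
      rw [div_lt_iff₀ hi]; linarith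
    have hd : (((n : ℚ) / (i : ℚ)).den : ℤ) ∣ (i : ℤ) := by
      have := Rat.den_dvd n (i : ℤ)
      rw [Rat.divInt_eq_div] at this
      exact_mod_cast this
    have hle : (((n : ℚ) / (i : ℚ)).den : ℤ) ≤ (i : ℤ) :=
      Int.le_of_dvd (by exact_mod_cast hi1) hd
    have hf : IsFareyFrac h ((n : ℚ) / (i : ℚ)).num (((n : ℚ) / (i : ℚ)).den : ℤ) := by
      refine ⟨by exact_mod_cast Rat.den_pos _, by omega, ?_⟩
      rw [Int.isCoprime_iff_gcd_eq_one]
      exact ((n : ℚ) / (i : ℚ)).reduced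
    have key := hcons _ _ hf
    rw [Int.cast_natCast, Rat.num_div_den] at key
    rcases key with k | k <;> linarith
  have hxy : (i : ℚ) * (a' : ℚ) / (b' : ℚ) < (i : ℚ) * (a : ℚ) / (b : ℚ) := by
    rw [mul_div_assoc, mul_div_assoc]
    exact mul_lt_mul_of_pos_left hlt hi
  have hcf : ⌈(i : ℚ) * (a : ℚ) / (b : ℚ)⌉ - 1 = ⌊(i : ℚ) * (a' : ℚ) / (b' : ℚ)⌋ := by
    apply le_antisymm
    · rw [Int.le_floor]
      by_contra hc
      refine hno _ ⟨not_le.mp hc, ?_⟩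
      have := Int.ceil_lt_add_one ((i : ℚ) * (a : ℚ) / (b : ℚ))
      push_cast
      linarith
    · have : ⌊(i : ℚ) * (a' : ℚ) / (b' : ℚ)⌋ < ⌈(i : ℚ) * (a : ℚ) / (b : ℚ)⌉ :=
        Int.lt_ceil.mpr (lt_of_le_of_lt (Int.floor_le _) hxy)
      omega
  refine ⟨hno, hcf, ?_, ?_⟩
  · rw [← hcf]
    unfold phi
    rw [neg_div, Int.fract, Int.floor_neg]
    push_cast
    ring
  · unfold phi'
    rw [Int.fract]
    ring
end

section
/- Let S = S(h, a/b, Δ, τ, m) satisfy m ≥ w and m > bb't/h, and assume S is canonically defined. Then S is short if and only if both conditions (c1): t ≥ (h−b)w/b and (cunif): (b − b̄)m ≥ bb'[(h − b̄)w − b̄t]/h hold, where b̄ = b mod b'. -/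
open scoped Classical

open Eliahou

theorem farey_det (h : ℕ) (a b a' b' : ℤ) (hF : IsFareyPred h a b a' b') :
    a * b' - a' * b = 1 ∧ (h : ℤ) < b + b' := by
  obtain ⟨⟨hb, hbh, hab⟩, ⟨hb', hbh', hab'⟩, hlt, hnext⟩ := hF
  have hd : 0 < a * b' - a' * b := by
    have hbq : (0 : ℚ) < b := by exact_mod_cast hb
    have hbq' : (0 : ℚ) < b' := by exact_mod_cast hb'
    rw [div_lt_div_iff₀ hbq' hbq] at hlt
    have : a' * b < a * b' := by exact_mod_cast hlt
    linarith
  obtain ⟨u, v, huv⟩ := hab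
  -- u * a + v * b = 1
  obtain ⟨q, p, hq1, hq2, hpq⟩ : ∃ q p : ℤ, (h : ℤ) - b < q ∧ q ≤ h ∧ a * q - p * b = 1 := by
    refine ⟨h - (h - u) % b, -v - a * (-((h - u) / b)) + 0, ?_, ?_, ?_⟩
    · have := Int.emod_lt_of_pos ((h : ℤ) - u) hb
      linarith
    · have := Int.emod_nonneg ((h : ℤ) - u) hb.ne'
      linarith
    · have := Int.emod_add_mul_ediv ((h : ℤ) - u) b
      have e : ((h : ℤ) - u) % b = h - u - b * ((h - u) / b) := by linarith
      rw [e]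
      linear_combination huv
  have hq0 : 0 < q := by linarith
  have hcop : IsCoprime p q := ⟨-b, a, by linarith⟩
  have he : 0 ≤ a' * q - p * b' := by
    have hbq : (0 : ℚ) < b := by exact_mod_cast hb
    have hbq' : (0 : ℚ) < b' := by exact_mod_cast hb'
    have hqq : (0 : ℚ) < q := by exact_mod_cast hq0
    rcases hnext p q ⟨hq0, hq2, hcop⟩ with h1 | h1
    · rw [div_le_div_iff₀ hqq hbq'] at h1
      have : p * b' ≤ a' * q := by exact_mod_cast h1
      linarith
    · rw [div_le_div_iff₀ hbq hqq] at h1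
      have : a * q ≤ p * b := by exact_mod_cast h1
      linarith
  have hid : b' = b * (a' * q - p * b') + q * (a * b' - a' * b) := by
    linear_combination (-b') * hpq
  have he0 : a' * q - p * b' = 0 := by
    by_contra hne
    have h1 : 1 ≤ a' * q - p * b' := by omega
    nlinarith
  rw [he0] at hid
  have hid2 : b' = q * (a * b' - a' * b) := by linarith
  have ha' : a' = p * (a * b' - a' * b) := by
    have : q * (a' - p * (a * b' - a' * b)) = 0 := by
      linear_combination he0 + p * hid2
    rcases mul_eq_zero.mp this with h1 | h1
    · omega
    · linarith
  have hu : IsUnit (a * b' - a' * b) :=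
    hab'.isUnit_of_dvd' (Dvd.intro_left _ ha'.symm) (Dvd.intro_left _ hid2.symm)
  have h1 : a * b' - a' * b = 1 := by
    rcases Int.isUnit_iff.mp hu with h1 | h1 <;> omega
  refine ⟨h1, ?_⟩
  rw [h1] at hid2
  linarith

theorem core_ineq (h b b' k0 r j k s : ℤ) (X M W : ℚ) (hb : 0 < b) (hb' : 0 < b')
    (hk0 : b = b' * k0 + r) (hr1 : r < b') (hj : j = b * s - b' * k)
    (hs : 1 ≤ s) (hj1 : 1 ≤ j) (hjh : j ≤ h) (hh : h < b + b') (hb'h : b' ≤ h)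
    (hW : 0 ≤ W) (c1 : W ≤ b * X)
    (cu : b * (W - r * X) ≤ M * k0) (hint : h * (b * b' * X) ≤ h * M + b * b' * W) :
    b * (W - j * X) ≤ M * k := by
  have hbq : (0 : ℚ) < b := by exact_mod_cast hb
  have hbq' : (0 : ℚ) < b' := by exact_mod_cast hb'
  have hhq : (0 : ℚ) < h := by exact_mod_cast (lt_of_lt_of_le hb' hb'h)
  have hb'hq : (b' : ℚ) ≤ h := by exact_mod_cast hb'h
  have hsq : (1 : ℚ) ≤ s := by exact_mod_cast hs
  have hjq : (j : ℚ) = b * s - b' * k := by exact_mod_cast hj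
  have hk0q : (b : ℚ) = b' * k0 + r := by exact_mod_cast hk0
  have hk : 0 ≤ k := by
    by_contra hneg
    have : k ≤ -1 := by omega
    nlinarith
  have hkq : (0 : ℚ) ≤ k := by exact_mod_cast hk
  rcases le_or_gt (s * k0) k with hc | hc
  · have hβ : k - s * k0 < s := by
      have : b' * (k - s * k0) < b' * s := by nlinarith
      exact lt_of_mul_lt_mul_left this hb'.le
    obtain ⟨β, hβe⟩ : ∃ β, β = k - s * k0 := ⟨_, rfl⟩
    have hβ0 : (0 : ℚ) ≤ β := by exact_mod_cast (by omega : (0 : ℤ) ≤ β)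
    have hβs : (β : ℚ) ≤ s - 1 := by
      have : β ≤ s - 1 := by omega
      exact_mod_cast this
    have hke : (k : ℚ) = s * k0 + β := by
      have : k = s * k0 + β := by omega
      exact_mod_cast this
    have e1 : (s : ℚ) * (b * (W - r * X)) ≤ s * (M * k0) :=
      mul_le_mul_of_nonneg_left cu (by linarith)
    have h2 : b * b' * X - b * W ≤ M := by
      have : (h : ℚ) * (b * b' * X - b * W) ≤ h * M := by
        have : (b : ℚ) * W * b' ≤ b * W * h :=
          mul_le_mul_of_nonneg_left hb'hq (by positivity)
        linarith
      exact le_of_mul_le_mul_left this hhq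
    have e2 := mul_le_mul_of_nonneg_left h2 hβ0
    have e3 : (b * W) * β ≤ (b * W) * (s - 1) :=
      mul_le_mul_of_nonneg_left hβs (by positivity)
    have hje : (j : ℚ) = s * r - b' * β := by
      rw [hjq, hke, hk0q]; ring
    rw [hje, hke]
    linarith
  · have hk0p : 0 < k0 := by nlinarith
    have hk0pq : (0 : ℚ) < k0 := by exact_mod_cast hk0p
    have hcq : (k : ℚ) ≤ s * k0 := by exact_mod_cast hc.le
    have e1 := mul_le_mul_of_nonneg_left cu hkq
    have e2 : (s * k0 - k) * W ≤ (s * k0 - k) * (b * X) :=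
      mul_le_mul_of_nonneg_left c1 (by linarith)
    have e3 : (k0 * W) * 1 ≤ (k0 * W) * s :=
      mul_le_mul_of_nonneg_left hsq (by positivity)
    have e4 : (k0 : ℚ) * j - k * r = b * (s * k0 - k) := by
      rw [hjq, hk0q]; ring
    have e5 : ((k0 : ℚ) * W - k0 * j * X) ≤ k * (W - r * X) := by
      have : (k0 : ℚ) * j * X = k * r * X + b * (s * k0 - k) * X := by
        rw [← e4]; ring
      linarith
    have e6 := mul_le_mul_of_nonneg_left e5 hbq.le
    have : (k0 : ℚ) * (b * (W - j * X)) ≤ k0 * (M * k) := by linarith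
    exact le_of_mul_le_mul_left this hk0pq

theorem sumset_bounds (Γ : Finset ℤ) (l u : ℤ) (hl : ∀ g ∈ Γ, l ≤ g ∧ g ≤ u) (i : ℕ) :
    ∀ x ∈ sumset Γ i, i * l ≤ x ∧ x ≤ i * u := by
  induction i with
  | zero => intro x hx; simp [sumset] at hx; simp [hx]
  | succ n ih =>
    rintro x ⟨g, hg, y, hy, rfl⟩
    have h1 := ih y hy
    have h2 := hl g hg
    push_cast
    constructor <;> linarith [h1.1, h1.2, h2.1, h2.2]

theorem mul_mem_sumset (Γ : Finset ℤ) (l : ℤ) (hl : l ∈ Γ) (i : ℕ) :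
    (i : ℤ) * l ∈ sumset Γ i := by
  induction i with
  | zero => simp [sumset]
  | succ n ih => exact ⟨l, hl, _, ih, by push_cast; ring⟩

theorem mem_Sgam (h : ℕ) (a b τ m : ℤ) (Δ : Finset ℕ) (g : ℤ) :
    g ∈ Sgam h a b τ m Δ ↔ ∃ δ ∈ Δ, Sbase h a b τ m - (δ : ℤ) = g := by
  unfold Sgam
  simp only [Finset.mem_image, Finset.bind_def, Finset.mem_sup, Finset.pure_def,
    Finset.mem_singleton]
  constructor
  · rintro ⟨x, ⟨δ, hδ, rfl⟩, rfl⟩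
    exact ⟨δ, hδ, rfl⟩
  · rintro ⟨δ, hδ, rfl⟩
    exact ⟨_, ⟨δ, hδ, rfl⟩, rfl⟩

/-- Per-index condition. -/
theorem short_iff (h : ℕ) (hh : 2 ≤ h) (a b a' b' : ℤ) (hb : 0 < b) (hb' : 0 < b')
    (hdet : a * b' - a' * b = 1) (Δ : Finset ℕ) (hΔ : Δ.Nonempty) (τ m : ℤ) (hm : 0 < m)
    (hint : (b : ℚ) * (b' : ℚ) * St h a b τ m / (h : ℚ) < (m : ℚ)) :
    IsShort h a b a' b' τ m Δ ↔ ∀ j : ℤ, 1 ≤ j → j ≤ h →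
      ∀ K : ℤ, K * b' ≤ j * a' → j * a' < (K + 1) * b' →
      (b : ℚ) * (h * (Sw h a b τ m Δ : ℚ) - j * ((Sw h a b τ m Δ : ℚ) + St h a b τ m))
        ≤ h * m * ((b * (K + 1) - j * a : ℤ) : ℚ) := by
  have hbq : (0 : ℚ) < b := by exact_mod_cast hb
  have hbq' : (0 : ℚ) < b' := by exact_mod_cast hb'
  have hmq : (0 : ℚ) < m := by exact_mod_cast hm
  have hhq : (0 : ℚ) < h := by exact_mod_cast (by omega : 0 < h)
  have hhz : (0 : ℤ) < h := by exact_mod_cast (by omega : 0 < h)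
  have hdq : (a : ℚ) * b' - a' * b = 1 := by exact_mod_cast hdet
  have hbt : (b : ℚ) * St h a b τ m = a * h * m - b * (Sc h a b τ m + m) := by
    unfold St; field_simp; ring
  -- bounds on Gamma
  have hG : ∀ g ∈ Sgam h a b τ m Δ, gamma1 h a b τ m Δ ≤ g ∧ g ≤ Sbase h a b τ m := by
    intro g hg
    obtain ⟨δ, hδ, rfl⟩ := (mem_Sgam _ _ _ _ _ _ _).mp hg
    have : δ ≤ delta1 Δ := Finset.le_sup (f := id) hδ
    unfold gamma1
    constructor <;> omega
  have hg1 : gamma1 h a b τ m Δ ∈ Sgam h a b τ m Δ := by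
    obtain ⟨δ, hδ, he⟩ := Finset.exists_mem_eq_sup Δ hΔ id
    refine (mem_Sgam _ _ _ _ _ _ _).mpr ⟨δ, hδ, ?_⟩
    unfold gamma1 delta1
    rw [he]; rfl
  have hbase : (h : ℤ) * Sbase h a b τ m ≤ Sc h a b τ m + m := by
    have := Int.floor_le (((Sc h a b τ m + m - 1 : ℤ) : ℚ) / (h : ℚ))
    rw [le_div_iff₀ hhq] at this
    have h2 : Sbase h a b τ m * (h : ℤ) ≤ Sc h a b τ m + m - 1 := by
      unfold Sbase; exact_mod_cast this
    linarith
  have hw : (Sw h a b τ m Δ : ℚ) = Sc h a b τ m + m - h * gamma1 h a b τ m Δ := by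
    unfold Sw; push_cast; ring
  -- N * b' > a' h m
  have hN : a' * (h * m) < (Sc h a b τ m + m) * b' := by
    rw [div_lt_iff₀ hhq] at hint
    have : (a' : ℚ) * (h * m) < (Sc h a b τ m + m) * b' := by
      have e : (b : ℚ) * (a' * (h * m)) < b * ((Sc h a b τ m + m) * b') := by
        have : (b : ℚ) * b' * St h a b τ m = b' * (b * St h a b τ m) := by ring
        rw [this, hbt] at hint
        have e2 : (a : ℚ) * b' * (h * m) = (1 + a' * b) * (h * m) := by
          rw [← hdq]; ring
        linarith
      exact lt_of_mul_lt_mul_left e hbq.le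
    exact_mod_cast this
  -- translation of the inequality
  have key : ∀ i : ℕ, ∀ j K : ℤ, j = h - i →
      (Sc h a b τ m - i * gamma1 h a b τ m Δ ≤ K * m ↔
      (b : ℚ) * (h * (Sw h a b τ m Δ : ℚ) - j * ((Sw h a b τ m Δ : ℚ) + St h a b τ m))
        ≤ h * m * ((b * (K + 1) - j * a : ℤ) : ℚ)) := by
    intro i j K hji
    have hiq : (i : ℚ) = h - j := by
      have : (i : ℤ) = h - j := by omega
      exact_mod_cast this
    have e0 : (Sc h a b τ m - i * gamma1 h a b τ m Δ ≤ K * m) ↔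
       (b * h : ℚ) * ((Sc h a b τ m : ℚ) - (h - j) * gamma1 h a b τ m Δ) ≤ (b * h) * (K * m) := by
      rw [mul_le_mul_iff_right₀ (by positivity), ← hiq]
      exact_mod_cast Iff.rfl
    rw [e0, ← sub_nonneg, ← sub_nonneg (b := (b : ℚ) * _)]
    have : (b * h : ℚ) * (K * m) - (b * h) * ((Sc h a b τ m : ℚ) - (h - j) * gamma1 h a b τ m Δ)
      = h * m * ((b * (K + 1) - j * a : ℤ) : ℚ) - 
      (b : ℚ) * (h * (Sw h a b τ m Δ : ℚ) - j * ((Sw h a b τ m Δ : ℚ) + St h a b τ m)) := by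
      rw [hw]; push_cast
      linear_combination (-(j : ℚ)) * hbt
    rw [this]
  have hK : ∀ i : ℕ, ∀ j K : ℤ, j = h - i → 
      (shortBound h a' b' i = K ↔ K * b' ≤ j * a' ∧ j * a' < (K + 1) * b') := by
    intro i j K hji
    have hiq : (h : ℚ) - i = j := by rw [hji]; push_cast; ring
    unfold shortBound
    rw [hiq, Int.floor_eq_iff, le_div_iff₀ hbq', div_lt_iff₀ hbq']
    exact_mod_cast Iff.rfl
  have hC : ∀ lam K : ℤ, ceilCount (Sc h a b τ m) m lam ≤ K ↔ Sc h a b τ m - lam ≤ K * m := by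
    intro lam K
    unfold ceilCount
    rw [Int.ceil_le, div_le_iff₀ hmq]
    exact_mod_cast Iff.rfl
  constructor
  · intro hS j hj1 hjh K hK1 hK2
    obtain ⟨i, hi⟩ : ∃ i : ℕ, (i : ℤ) = h - j := ⟨(h - j).toNat, by omega⟩
    have h1 := hS i (by omega) _ (mul_mem_sumset _ _ hg1 i)
    rw [(hK i j K (by omega)).mpr ⟨hK1, hK2⟩] at h1
    exact (key i j K (by omega)).mp ((hC _ _).mp h1.le)
  · intro H i hi lam hlam
    obtain ⟨K, hKe⟩ : ∃ K, shortBound h a' b' i = K := ⟨_, rfl⟩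
    obtain ⟨j, hj⟩ : ∃ j : ℤ, j = h - i := ⟨_, rfl⟩
    obtain ⟨hK1, hK2⟩ := (hK i j K hj).mp hKe
    have h1 := (key i j K hj).mpr (H j (by omega) (by omega) K hK1 hK2)
    obtain ⟨hl1, hl2⟩ := sumset_bounds _ _ _ hG i lam hlam
    rw [hKe]
    apply le_antisymm
    · rw [hC]; linarith
    · by_contra hlt
      have h3 : ceilCount (Sc h a b τ m) m lam ≤ K - 1 := by omega
      rw [hC] at h3
      have hjp : 0 < j := by omega
      have hiz : (i : ℤ) = h - j := by omega
      have a1 : (h : ℤ) * lam ≤ i * (Sc h a b τ m + m) := by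
        calc (h : ℤ) * lam ≤ h * (i * Sbase h a b τ m) := mul_le_mul_of_nonneg_left hl2 hhz.le
          _ = i * (h * Sbase h a b τ m) := by ring
          _ ≤ _ := mul_le_mul_of_nonneg_left hbase (by positivity)
      -- h c - h lam ≤ h (K-1) m
      have a2 : (h : ℤ) * (Sc h a b τ m - lam) ≤ h * ((K - 1) * m) :=
        mul_le_mul_of_nonneg_left h3 hhz.le
      rw [hiz] at a1
      have a3 : j * (Sc h a b τ m + m) ≤ h * m * K := by linarith
      have a4 := mul_lt_mul_of_pos_left hN hjp
      have a5 := mul_le_mul_of_nonneg_right a3 hb'.le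
      have a6 := mul_le_mul_of_nonneg_left hK1 (by positivity : (0 : ℤ) ≤ h * m)
      linarith

/-- **Theorem criteria (i).** If `S = S(h, a/b, Δ, τ, m)` (with
`m ≥ w` and `m > bb't/h`) is canonically defined, then `S` is short iff
`(c1): t ≥ (h−b)w/b` and `(cunif): (b − b̄)m ≥ bb'[(h − b̄)w − b̄t]/h` both
hold, where `b̄ = b mod b'`. -/
theorem short_criterion (h : ℕ) (hh : 2 ≤ h) (a b a' b' : ℤ)
    (hF : IsFareyPred h a b a' b') (Δ : Finset ℕ) (hΔ : Δ.Nonempty) (τ m : ℤ)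
    (hreg : Sw h a b τ m Δ ≤ m)
    (hint : (b : ℚ) * (b' : ℚ) * St h a b τ m / (h : ℚ) < (m : ℚ))
    (hcan : IsCanonical h a b τ m Δ) :
    IsShort h a b a' b' τ m Δ ↔
      (((h : ℚ) - (b : ℚ)) * ((Sw h a b τ m Δ : ℤ) : ℚ) / (b : ℚ) ≤ St h a b τ m ∧
        (b : ℚ) * (b' : ℚ) *
            (((h : ℚ) - ((b % b' : ℤ) : ℚ)) * ((Sw h a b τ m Δ : ℤ) : ℚ)
              - ((b % b' : ℤ) : ℚ) * St h a b τ m) / (h : ℚ)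
          ≤ ((b - b % b' : ℤ) : ℚ) * (m : ℚ)) := by
  obtain ⟨hdet, hbb⟩ := farey_det h a b a' b' hF
  obtain ⟨⟨hb, hbh, -⟩, ⟨hb', hbh', -⟩, -, -⟩ := hF
  have hhq : (0 : ℚ) < h := by exact_mod_cast (by omega : 0 < h)
  have hhz : (0 : ℤ) < h := by exact_mod_cast (by omega : 0 < h)
  have hbq : (0 : ℚ) < b := by exact_mod_cast hb
  have hbq' : (0 : ℚ) < b' := by exact_mod_cast hb'
  have hw1 : 1 ≤ Sw h a b τ m Δ := by
    have := Int.floor_le (((Sc h a b τ m + m - 1 : ℤ) : ℚ) / (h : ℚ))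
    rw [le_div_iff₀ hhq] at this
    have h2 : Sbase h a b τ m * (h : ℤ) ≤ Sc h a b τ m + m - 1 := by
      unfold Sbase; exact_mod_cast this
    have h3 : 0 ≤ (h : ℤ) * (delta1 Δ : ℤ) := by positivity
    unfold Sw gamma1
    linarith
  have hm : 0 < m := by linarith
  have hmq : (0 : ℚ) < m := by exact_mod_cast hm
  rw [short_iff h hh a b a' b' hb hb' hdet Δ hΔ τ m hm hint]
  have hwq : (1 : ℚ) ≤ (Sw h a b τ m Δ : ℚ) := by exact_mod_cast hw1
  have hregq : (Sw h a b τ m Δ : ℚ) ≤ m := by exact_mod_cast hreg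
  generalize (Sw h a b τ m Δ : ℚ) = w at *
  generalize St h a b τ m = t at *
  have hr0 := Int.emod_nonneg b hb'.ne'
  have hr1 := Int.emod_lt_of_pos b hb'
  have hk0 : b = b' * (b / b') + b % b' := by
    have := Int.emod_add_mul_ediv b b'; linarith
  generalize b % b' = r at *
  generalize b / b' = k0 at *
  have hk0q : (b : ℚ) = b' * k0 + r := by exact_mod_cast hk0
  have hdq : (a : ℚ) * b' - a' * b = 1 := by exact_mod_cast hdet
  have c1iff : ((h : ℚ) - b) * w / b ≤ t ↔ h * w ≤ b * (w + t) := by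
    rw [div_le_iff₀ hbq]
    constructor <;> intro H <;> linarith
  have cuiff : ((b : ℚ) * b' * ((h - r) * w - r * t) / h ≤ ((b - r : ℤ) : ℚ) * m) ↔
      b * (h * w - r * (w + t)) ≤ h * m * k0 := by
    rw [div_le_iff₀ hhq,
      ← mul_le_mul_iff_right₀ (b := (b : ℚ) * (h * w - r * (w + t))) hbq']
    have e : ((b - r : ℤ) : ℚ) = b' * k0 := by push_cast; linarith
    rw [e]
    constructor <;> intro H <;> linarith
  rw [c1iff, cuiff]
  constructor
  · intro H
    constructor
    · have := H b (by omega) hbh (a - 1) (by nlinarith) (by nlinarith)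
      have e : ((b * (a - 1 + 1) - b * a : ℤ) : ℚ) = 0 := by push_cast; ring
      rw [e, mul_zero] at this
      have h2 : (b : ℚ) * (h * w - b * (w + t)) ≤ b * 0 := by simpa using this
      have := le_of_mul_le_mul_left h2 hbq
      linarith
    · rcases hr0.lt_or_eq with hr | hr
      · -- j = r, K = a - 1 - a' k0
        have e : r = b - b' * k0 := by linarith
        have := H r (by omega) (by omega) (a - 1 - a' * k0)
          (by rw [e]; nlinarith) (by rw [e]; nlinarith)
        have e2 : b * (a - 1 - a' * k0 + 1) - r * a = k0 := by
          rw [e]; linear_combination k0 * hdet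
        rw [e2] at this
        exact this
      · have hb1 : b' = 1 := by
          have : b' ∣ 1 := ⟨a - a' * k0, by rw [← hr] at hk0; linear_combination (-1 : ℤ) * hdet - a' * hk0⟩
          exact Int.eq_one_of_dvd_one hb'.le this
        have e : (k0 : ℚ) = b := by
          rw [hk0q, ← hr, hb1]; simp
        rw [e, ← hr]
        have := mul_le_mul_of_nonneg_left hregq (by positivity : (0 : ℚ) ≤ b * h)
        push_cast
        linarith
  · rintro ⟨c1, cu⟩ j hj1 hjh K hK1 hK2
    refine core_ineq h b b' k0 r j _ ((K + 1) * b' - j * a') (w + t) (h * m) (h * w) hb hb' hk0 hr1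
      ?_ (by omega) hj1 hjh hbb hbh' (by positivity) c1 cu ?_
    · linear_combination (-j) * hdet
    · rw [div_lt_iff₀ hhq] at hint
      have := mul_lt_mul_of_pos_left hint hhq
      push_cast
      linarith
end

section
/- Let h ≥ 1 be an integer, a'/b' < a/b consecutive h-Farey fractions, ℓ ≥ 1, and set φᵢ = frac(−ia/b), φ'ᵢ = frac(ia'/b'), sᵢ = C(ℓ+i−2, i), s_h = C(ℓ+h−2, h) and s = C(ℓ+h−1, h). Then the following four expressions are equal: (1) −ℓ Σ_{i=0}^{h−1} φ'_{h−i} sᵢ + φ'_h s; (2) −(h−1)s_h + ℓ Σ_{i=0}^{h−1} φ_{h−i} sᵢ − φ_h s; (3) −⌊hφ'₁⌋ s + ℓ Σ_{j=1}^{⌊hφ'₁⌋} C(ℓ + h − ⌈j/φ'₁⌉ − 1, h − ⌈j/φ'₁⌉); (4) −(h−1)s_h + ⌊hφ₁⌋ s − ℓ Σ_{j=1}^{⌊hφ₁⌋} C(ℓ + h − ⌈j/φ₁⌉ − 1, h − ⌈j/φ₁⌉). -/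
open scoped Classical

open Eliahou

theorem aux_svec_sum (l : ℕ) (hl : 1 ≤ l) (n : ℕ) :
    ∑ i ∈ Finset.range (n + 1), svec l i = (l + n - 1).choose n := by
  obtain ⟨k, rfl⟩ : ∃ k, l = k + 1 := ⟨l - 1, by omega⟩
  induction n with
  | zero => simp [svec]
  | succ n ih =>
    rw [Finset.sum_range_succ, ih, svec]
    have h1 : k + 1 + n - 1 = k + n := by omega
    have h2 : k + 1 + (n + 1) - 2 = k + n := by omega
    have h3 : k + 1 + (n + 1) - 1 = k + n + 1 := by omega
    rw [h1, h2, h3, Nat.choose_succ_succ]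

theorem aux_weighted (l : ℕ) (hl : 1 ≤ l) (h : ℕ) :
    (l : ℚ) * ∑ i ∈ Finset.range h, ((h - i : ℕ) : ℚ) * (svec l i : ℚ)
      = h * ((l + h - 1).choose h : ℚ) := by
  obtain ⟨k, rfl⟩ : ∃ k, l = k + 1 := ⟨l - 1, by omega⟩
  have key : ∀ n : ℕ, ∑ i ∈ Finset.range (n + 1), ((n + 1 - i : ℕ) : ℚ) * (svec (k + 1) i : ℚ)
      = ((k + 1 + n).choose n : ℚ) := by
    intro n
    induction n with
    | zero => simp [svec]
    | succ n ih =>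
      have e : ∑ i ∈ Finset.range (n + 1 + 1), ((n + 1 + 1 - i : ℕ) : ℚ) * (svec (k + 1) i : ℚ)
          = ∑ i ∈ Finset.range (n + 1 + 1), ((n + 1 - i : ℕ) : ℚ) * (svec (k + 1) i : ℚ)
            + ∑ i ∈ Finset.range (n + 1 + 1), (svec (k + 1) i : ℚ) := by
        rw [← Finset.sum_add_distrib]
        refine Finset.sum_congr rfl fun i hi => ?_
        have : i ≤ n + 1 := by have := Finset.mem_range.1 hi; omega
        have : n + 1 + 1 - i = (n + 1 - i) + 1 := by omega
        rw [this]; push_cast; ring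
      rw [e, Finset.sum_range_succ, ih, ← Nat.cast_sum, aux_svec_sum _ hl]
      have h1 : k + 1 + (n + 1) - 1 = k + 1 + n := by omega
      have h2 : k + 1 + (n + 1) = k + 1 + n + 1 := by omega
      rw [h1, h2, Nat.choose_succ_succ (k + 1 + n) n]
      simp
  cases h with
  | zero => simp
  | succ n =>
    rw [key n]
    have h1 : k + 1 + (n + 1) - 1 = k + 1 + n := by omega
    rw [h1]
    have := Nat.choose_succ_right_eq (k + 1 + n) n
    have h2 : k + 1 + n - n = k + 1 := by omega
    rw [h2] at this
    have h3 : (((k + 1 + n).choose (n + 1) : ℕ) : ℚ) * ((n + 1 : ℕ) : ℚ)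
      = ((k + 1 + n).choose n : ℚ) * ((k + 1 : ℕ) : ℚ) := by exact_mod_cast this
    linarith

theorem aux_floor (l : ℕ) (hl : 1 ≤ l) (h : ℕ) (x : ℚ) (hx : 0 ≤ x) :
    ∑ i ∈ Finset.range h, ((⌊((h - i : ℕ) : ℚ) * x⌋ : ℤ) : ℚ) * (svec l i : ℚ)
      = ∑ j ∈ Finset.Icc 1 (⌊(h : ℚ) * x⌋.toNat),
          ((l + h - (⌈(j : ℚ) / x⌉).toNat - 1).choose
            (h - (⌈(j : ℚ) / x⌉).toNat) : ℚ) := by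
  rcases hx.eq_or_lt with rfl | hx0
  · simp
  have hN : ⌊(h : ℚ) * x⌋.toNat = ⌊(h : ℚ) * x⌋₊ := rfl
  have h1 : ∀ i ∈ Finset.range h, ((⌊((h - i : ℕ) : ℚ) * x⌋ : ℤ) : ℚ) * (svec l i : ℚ)
      = ∑ j ∈ Finset.Icc 1 (⌊(h : ℚ) * x⌋.toNat),
        if (j : ℚ) ≤ ((h - i : ℕ) : ℚ) * x then (svec l i : ℚ) else 0 := by
    intro i hi
    rw [← Finset.sum_filter, Finset.sum_const, nsmul_eq_mul]
    congr 1
    have : (Finset.Icc 1 (⌊(h : ℚ) * x⌋.toNat)).filter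
        (fun j : ℕ => (j : ℚ) ≤ ((h - i : ℕ) : ℚ) * x) = Finset.Icc 1 ⌊((h - i : ℕ) : ℚ) * x⌋₊ := by
      ext j
      rw [hN, Finset.mem_filter, Finset.mem_Icc, Finset.mem_Icc,
        Nat.le_floor_iff (by positivity), Nat.le_floor_iff (by positivity)]
      have : ((h - i : ℕ) : ℚ) * x ≤ h * x := by
        gcongr
        omega
      constructor
      · rintro ⟨⟨a, b⟩, c⟩; exact ⟨a, c⟩
      · rintro ⟨a, c⟩; exact ⟨⟨a, c.trans this⟩, c⟩
    rw [this, Nat.card_Icc, Nat.add_sub_cancel]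
    have := Int.natCast_floor_eq_floor (R := ℚ) (a := ((h - i : ℕ) : ℚ) * x) (by positivity)
    rw [← this]; simp
  rw [Finset.sum_congr rfl h1, Finset.sum_comm]
  refine Finset.sum_congr rfl fun j hj => ?_
  rw [hN, Finset.mem_Icc, Nat.le_floor_iff (by positivity)] at hj
  obtain ⟨hj1, hj2⟩ := hj
  have hc : (⌈(j : ℚ) / x⌉).toNat = ⌈(j : ℚ) / x⌉₊ := rfl
  rw [hc]
  set c := ⌈(j : ℚ) / x⌉₊ with hcdef
  have hch : c ≤ h := by
    rw [hcdef, Nat.ceil_le, div_le_iff₀ hx0]; exact hj2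
  have hc1 : 1 ≤ c := by
    rw [hcdef, Nat.one_le_ceil_iff]
    have : (0 : ℚ) < j := by exact_mod_cast hj1
    positivity
  have h2 : l + h - c - 1 = l + (h - c) - 1 := by omega
  rw [h2, ← aux_svec_sum l hl, ← Finset.sum_filter, Nat.cast_sum]
  refine Finset.sum_congr ?_ fun _ _ => rfl
  ext i
  rw [Finset.mem_filter, Finset.mem_range, Finset.mem_range, ← div_le_iff₀ hx0, ← Nat.ceil_le]
  omega

theorem aux_main (l : ℕ) (hl : 1 ≤ l) (h : ℕ) (x : ℚ) (hx : 0 ≤ x) :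
    -(l : ℚ) * ∑ i ∈ Finset.range h, Int.fract (((h - i : ℕ) : ℚ) * x) * (svec l i : ℚ)
      + Int.fract ((h : ℚ) * x) * ((l + h - 1).choose h : ℚ)
    = -((⌊(h : ℚ) * x⌋ : ℤ) : ℚ) * ((l + h - 1).choose h : ℚ)
      + (l : ℚ) * ∑ j ∈ Finset.Icc 1 (⌊(h : ℚ) * x⌋.toNat),
          ((l + h - (⌈(j : ℚ) / x⌉).toNat - 1).choose
            (h - (⌈(j : ℚ) / x⌉).toNat) : ℚ) := by
  rw [← aux_floor l hl h x hx]
  have e : ∑ i ∈ Finset.range h, Int.fract (((h - i : ℕ) : ℚ) * x) * (svec l i : ℚ)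
      = x * ∑ i ∈ Finset.range h, ((h - i : ℕ) : ℚ) * (svec l i : ℚ)
        - ∑ i ∈ Finset.range h, ((⌊((h - i : ℕ) : ℚ) * x⌋ : ℤ) : ℚ) * (svec l i : ℚ) := by
    rw [Finset.mul_sum, ← Finset.sum_sub_distrib]
    refine Finset.sum_congr rfl fun i _ => ?_
    unfold Int.fract; ring
  rw [e]
  have := aux_weighted l hl h
  unfold Int.fract
  linear_combination (-x) * this

theorem aux_fract (n : ℕ) (y : ℚ) : Int.fract ((n : ℚ) * Int.fract y) = Int.fract ((n : ℚ) * y) := by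
  rw [Int.fract_eq_fract]
  refine ⟨-(n * ⌊y⌋), ?_⟩
  unfold Int.fract; push_cast; ring

theorem aux_phi (a b : ℤ) (n : ℕ) : phi a b n = Int.fract ((n : ℚ) * phi a b 1) := by
  unfold phi
  rw [aux_fract]; congr 1; push_cast; ring

theorem aux_phi' (a b : ℤ) (n : ℕ) : phi' a b n = Int.fract ((n : ℚ) * phi' a b 1) := by
  unfold phi'
  rw [aux_fract]; congr 1; push_cast; ring

theorem aux_rel (h : ℕ) (a b a' b' : ℤ) (hF : IsFareyPred h a b a' b') (n : ℕ)
    (hn : 1 ≤ n) (hnh : n ≤ h) :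
    phi a b n = 1 - phi' a' b' n + n * ((a' : ℚ) / b' - (a : ℚ) / b) := by
  obtain ⟨-, -, hlt, hno⟩ := hF
  have hn0 : (0 : ℚ) < n := by exact_mod_cast hn
  set y : ℚ := (a' : ℚ) / b'
  set z : ℚ := (a : ℚ) / b
  have hyz : (n : ℚ) * y < n * z := by gcongr
  have hz : (n : ℚ) * z ≤ ⌊(n : ℚ) * y⌋ + 1 := by
    set p : ℤ := ⌊(n : ℚ) * y⌋ + 1 with hp
    have hpy : (n : ℚ) * y < p := by rw [hp]; push_cast; exact Int.lt_floor_add_one _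
    have hfar : IsFareyFrac h ((p : ℚ) / n).num ((p : ℚ) / n).den := by
      refine ⟨by exact_mod_cast Rat.den_pos _, ?_, ?_⟩
      · have : ((((p : ℚ) / ((n : ℤ) : ℚ)).den : ℕ) : ℤ) ∣ (n : ℤ) := by
          rw [← Rat.divInt_eq_div]; exact Rat.den_dvd p n
        have := Int.le_of_dvd (by exact_mod_cast hn) this
        simp only [Int.cast_natCast] at this
        omega
      · rw [Int.isCoprime_iff_gcd_eq_one]
        exact Rat.reduced _
    have hval : ((((p : ℚ) / n).num : ℤ) : ℚ) / (((((p : ℚ) / n).den : ℕ) : ℤ) : ℚ) = (p : ℚ) / n := by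
      rw [Int.cast_natCast]; exact Rat.num_div_den _
    rcases hno _ _ hfar with hc | hc
    · rw [hval, div_le_iff₀ hn0] at hc; linarith
    · rw [hval, le_div_iff₀ hn0] at hc
      rw [hp] at hc; push_cast at hc; linarith
  have hfl : ⌊-((n : ℚ) * z)⌋ = -(⌊(n : ℚ) * y⌋ + 1) := by
    rw [Int.floor_eq_iff]
    push_cast
    have := Int.floor_le ((n : ℚ) * y)
    constructor <;> linarith
  unfold phi phi'
  have e1 : -((n : ℚ) * a) / b = -((n : ℚ) * z) := by simp only [z]; ring
  have e2 : (n : ℚ) * a' / b' = (n : ℚ) * y := by simp only [y]; ring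
  rw [e1, e2]
  unfold Int.fract
  rw [hfl]; push_cast; ring

theorem aux_e12 (h : ℕ) (hh : 1 ≤ h) (a b a' b' : ℤ) (hF : IsFareyPred h a b a' b')
    (l : ℕ) (hl : 1 ≤ l) :
    E0 h a' b' l = -((h : ℚ) - 1) * (svec l h : ℚ)
      + (l : ℚ) * ∑ i ∈ Finset.range h, phi a b (h - i) * (svec l i : ℚ)
      - phi a b h * ((l + h - 1).choose h : ℚ) := by
  unfold E0
  set d : ℚ := (a' : ℚ) / b' - (a : ℚ) / b with hd
  have e : ∑ i ∈ Finset.range h, phi a b (h - i) * (svec l i : ℚ)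
      = ∑ i ∈ Finset.range h, (svec l i : ℚ)
        - ∑ i ∈ Finset.range h, phi' a' b' (h - i) * (svec l i : ℚ)
        + d * ∑ i ∈ Finset.range h, ((h - i : ℕ) : ℚ) * (svec l i : ℚ) := by
    rw [Finset.mul_sum, ← Finset.sum_sub_distrib, ← Finset.sum_add_distrib]
    refine Finset.sum_congr rfl fun i hi => ?_
    have := Finset.mem_range.1 hi
    rw [aux_rel h a b a' b' hF (h - i) (by omega) (by omega), hd]; ring
  rw [e, aux_rel h a b a' b' hF h hh le_rfl, ← hd]
  have hw := aux_weighted l hl h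
  obtain ⟨n, rfl⟩ : ∃ n, h = n + 1 := ⟨h - 1, by omega⟩
  have hs1 := aux_svec_sum l hl (n + 1)
  rw [Finset.sum_range_succ] at hs1
  have hs0 := aux_svec_sum l hl n
  obtain ⟨k, rfl⟩ : ∃ k, l = k + 1 := ⟨l - 1, by omega⟩
  have hc : svec (k + 1) (n + 1) * (n + 1) = (k + 1 + n - 1).choose n * k := by
    unfold svec
    have h1 : k + 1 + (n + 1) - 2 = k + n := by omega
    have h2 : k + 1 + n - 1 = k + n := by omega
    rw [h1, h2, Nat.choose_succ_right_eq, Nat.add_sub_cancel]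
  rw [← hs0] at hc
  have hs1' : ∑ i ∈ Finset.range (n + 1), (svec (k + 1) i : ℚ) + (svec (k + 1) (n + 1) : ℚ)
      = ((k + 1 + (n + 1) - 1).choose (n + 1) : ℚ) := by exact_mod_cast hs1
  have hc' : (svec (k + 1) (n + 1) : ℚ) * (n + 1)
      = (∑ i ∈ Finset.range (n + 1), (svec (k + 1) i : ℚ)) * k := by exact_mod_cast hc
  push_cast at hw ⊢
  linear_combination (-d) * hw + hc' - hs1'


/-- **Theorem E, equivalent forms of `E₀`.** For consecutive
`h`-Farey fractions `a'/b' < a/b` and `ℓ ≥ 1`, the four expressions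
(E'), (E), (E'a), (Ea) for `E₀` are equal. -/
theorem E0_four_forms (h : ℕ) (hh : 1 ≤ h) (a b a' b' : ℤ)
    (hF : IsFareyPred h a b a' b') (l : ℕ) (hl : 1 ≤ l) :
    let s : ℚ := ((l + h - 1).choose h : ℚ)
    let e1 : ℚ := E0 h a' b' l
    let e2 : ℚ := -((h : ℚ) - 1) * (svec l h : ℚ)
      + (l : ℚ) * ∑ i ∈ Finset.range h, phi a b (h - i) * (svec l i : ℚ)
      - phi a b h * s
    let e3 : ℚ := -((⌊(h : ℚ) * phi' a' b' 1⌋ : ℤ) : ℚ) * s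
      + (l : ℚ) * ∑ j ∈ Finset.Icc 1 (⌊(h : ℚ) * phi' a' b' 1⌋.toNat),
          ((l + h - (⌈(j : ℚ) / phi' a' b' 1⌉).toNat - 1).choose
            (h - (⌈(j : ℚ) / phi' a' b' 1⌉).toNat) : ℚ)
    let e4 : ℚ := -((h : ℚ) - 1) * (svec l h : ℚ)
      + ((⌊(h : ℚ) * phi a b 1⌋ : ℤ) : ℚ) * s
      - (l : ℚ) * ∑ j ∈ Finset.Icc 1 (⌊(h : ℚ) * phi a b 1⌋.toNat),
          ((l + h - (⌈(j : ℚ) / phi a b 1⌉).toNat - 1).choose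
            (h - (⌈(j : ℚ) / phi a b 1⌉).toNat) : ℚ)
    e1 = e2 ∧ e1 = e3 ∧ e1 = e4 := by
  intro s e1 e2 e3 e4
  have h12 : e1 = e2 := aux_e12 h hh a b a' b' hF l hl
  refine ⟨h12, ?_, ?_⟩
  · have := aux_main l hl h (phi' a' b' 1) (Int.fract_nonneg _)
    simp only [← aux_phi'] at this
    exact this
  · rw [h12]
    have := aux_main l hl h (phi a b 1) (Int.fract_nonneg _)
    simp only [← aux_phi] at this
    simp only [e2, e4, s]
    linear_combination -this
end

section
/- Let h ≥ 2 be an integer, a'/b' < a/b consecutive h-Farey fractions with b' ≠ 1, and ℓ ≥ 3. Then E₀ < 0, where E₀ = −ℓ Σ_{i=0}^{h−1} φ'_{h−i} sᵢ + φ'_h s with φ'ᵢ = frac(ia'/b'), sᵢ = C(ℓ+i−2, i) and s = C(ℓ+h−1, h). -/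
open scoped Classical

open Eliahou

open Finset in
theorem mc_sum (m h : ℕ) :
    ∑ p ∈ antidiagonal h, (Nat.multichoose m p.2 : ℚ) = Nat.multichoose (m+1) h := by
  induction h with
  | zero => simp
  | succ n ih =>
    rw [Finset.Nat.sum_antidiagonal_succ, ih, Nat.multichoose_succ_succ]
    push_cast; ring

open Finset in
theorem triple_swap (φ g : ℕ → ℚ) (h : ℕ) :
    ∑ p ∈ antidiagonal h, φ p.1 * ∑ q ∈ antidiagonal p.2, g q.2
      = ∑ p ∈ antidiagonal h, ∑ q ∈ antidiagonal p.2, φ q.1 * g q.2 := by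
  have := congrArg (PowerSeries.coeff h) (mul_left_comm (PowerSeries.mk φ)
    (PowerSeries.mk fun _ => (1:ℚ)) (PowerSeries.mk g))
  simpa [PowerSeries.coeff_mul] using this

open Finset in
theorem step_eq (φ : ℕ → ℚ) (m h : ℕ) :
    ((m:ℚ)+2) * ∑ p ∈ antidiagonal h, φ p.1 * (Nat.multichoose (m+1) p.2 : ℚ)
     = ∑ p ∈ antidiagonal h, (φ p.1 * (Nat.multichoose (m+1) p.2 : ℚ) +
        ((m:ℚ)+1) * ∑ q ∈ antidiagonal p.2, φ q.1 * (Nat.multichoose m q.2 : ℚ)) := by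
  rw [sum_add_distrib, ← mul_sum, ← triple_swap φ (fun j => (Nat.multichoose m j : ℚ))]
  simp only [mc_sum]
  ring

open Finset in
theorem weak (φ : ℕ → ℚ) (hs : ∀ i j, φ (i+j) ≤ φ i + φ j) (m : ℕ) : ∀ h,
    φ h * (Nat.multichoose (m+1) h : ℚ) ≤
    ((m:ℚ)+1) * ∑ p ∈ antidiagonal h, φ p.1 * (Nat.multichoose m p.2 : ℚ) := by
  induction m with
  | zero =>
    intro h
    cases h with
    | zero => simp
    | succ n =>
      rw [Finset.Nat.sum_antidiagonal_succ']
      simp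
  | succ m ih =>
    intro h
    push_cast
    rw [show (m:ℚ)+1+1 = m+2 by ring, step_eq, ← mc_sum, mul_sum]
    apply sum_le_sum
    intro p hp
    have h1 := ih p.2
    have h2 := hs p.1 p.2
    rw [mem_antidiagonal.1 hp] at h2
    have h3 : (0:ℚ) ≤ Nat.multichoose (m+1) p.2 := by positivity
    nlinarith [mul_le_mul_of_nonneg_right h2 h3]

open Finset in
theorem strict (φ : ℕ → ℚ) (hs : ∀ i j, φ (i+j) ≤ φ i + φ j) (h0 : ∀ i, 0 ≤ φ i)
    (h1 : 0 < φ 1) (b : ℕ) (hb1 : 1 ≤ b) (hb : φ b = 0) (m h : ℕ) (hbh : b ≤ h) :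
    φ h * (Nat.multichoose (m+3) h : ℚ) <
    ((m:ℚ)+3) * ∑ p ∈ antidiagonal h, φ p.1 * (Nat.multichoose (m+2) p.2 : ℚ) := by
  have e := step_eq φ (m+1) h
  push_cast at e
  rw [show (m:ℚ)+1+2 = m+3 by ring] at e
  rw [e, ← mc_sum, mul_sum]
  apply sum_lt_sum
  · intro p hp
    have h1 := weak φ hs (m+1) p.2
    have h2 := hs p.1 p.2
    rw [mem_antidiagonal.1 hp] at h2
    have h3 : (0:ℚ) ≤ Nat.multichoose (m+2) p.2 := by positivity
    push_cast at h1
    nlinarith [mul_le_mul_of_nonneg_right h2 h3]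
  · refine ⟨(h-b, b), by simp; omega, ?_⟩
    have h2 := hs (h-b) b
    rw [Nat.sub_add_cancel hbh, hb] at h2
    have h3 : (0:ℚ) ≤ Nat.multichoose (m+2) b := by positivity
    have h4 : 0 < ∑ q ∈ antidiagonal b, φ q.1 * (Nat.multichoose (m+1) q.2 : ℚ) := by
      apply sum_pos'
      · intro q _
        exact mul_nonneg (h0 _) (by positivity)
      · refine ⟨(1, b-1), by simp; omega, mul_pos h1 ?_⟩
        simp only [Nat.multichoose_eq]
        exact_mod_cast Nat.choose_pos (by omega)
    have h5 : 0 < ((m:ℚ)+1+1) * ∑ q ∈ antidiagonal b, φ q.1 * (Nat.multichoose (m+1) q.2 : ℚ) := by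
      positivity
    have h6 := mul_le_mul_of_nonneg_right h2 h3
    simp only
    linarith

/-- **Lemma Eneg.** If `a'/b' < a/b` are consecutive `h`-Farey
fractions with `b' ≠ 1` and `ℓ ≥ 3`, then `E₀ < 0`. -/
theorem E0_neg (h : ℕ) (hh : 2 ≤ h) (a b a' b' : ℤ)
    (hF : IsFareyPred h a b a' b') (hb' : b' ≠ 1) (l : ℕ) (hl : 3 ≤ l) :
    E0 h a' b' l < 0 := by
  obtain ⟨-, ⟨hb0, hbh, hc⟩, -, -⟩ := hF
  obtain ⟨m, rfl⟩ : ∃ m, l = m + 3 := ⟨l - 3, by omega⟩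
  lift b' to ℕ using hb0.le
  have hbq : (b' : ℚ) ≠ 0 := by
    have : b' ≠ 0 := by omega
    exact_mod_cast this
  have key := strict (phi' a' b') ?_ ?_ ?_ b' (by omega) ?_ m h (by omega)
  · rw [Finset.Nat.sum_antidiagonal_eq_sum_range_succ_mk, ← Finset.sum_range_reflect,
      Finset.sum_range_succ] at key
    have e : ∑ i ∈ Finset.range h, phi' a' b' (h - i) * (svec (m+3) i : ℚ)
        = ∑ j ∈ Finset.range h, phi' a' b' (h + 1 - 1 - j) *
          (Nat.multichoose (m+2) (h - (h + 1 - 1 - j)) : ℚ) := by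
      apply Finset.sum_congr rfl
      intro i hi
      have := Finset.mem_range.1 hi
      rw [svec, Nat.multichoose_eq, show h - (h+1-1-i) = i by omega,
        show h + 1 - 1 - i = h - i by omega, show m + 3 + i - 2 = m + 2 + i - 1 by omega]
    have z : phi' a' b' 0 = 0 := by simp [phi']
    simp only [Nat.succ_eq_add_one] at key
    rw [← e, show h + 1 - 1 - h = 0 by omega, z, Nat.multichoose_eq] at key
    rw [E0]
    push_cast
    linarith
  · intro i j
    unfold phi'
    have := Int.fract_add_le ((i:ℚ) * a' / (b':ℤ)) ((j:ℚ) * a' / (b':ℤ))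
    rw [← add_div, ← add_mul, ← Nat.cast_add] at this
    exact this
  · intro i; exact Int.fract_nonneg _
  · unfold phi'
    refine lt_of_le_of_ne (Int.fract_nonneg _) (Ne.symm ?_)
    intro hz
    rw [Int.fract_eq_zero_iff] at hz
    obtain ⟨z, hz⟩ := hz
    have : (a':ℚ) = z * b' := by
      push_cast at hz
      field_simp at hz
      linarith
    have h2 : a' = z * b' := by exact_mod_cast this
    have h3 : IsUnit (b':ℤ) := hc.isUnit_of_dvd' ⟨z, by rw [h2]; ring⟩ dvd_rfl
    rw [Int.isUnit_iff] at h3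
    omega
  · unfold phi'
    rw [show ((b':ℕ):ℚ) * a' / ((b':ℤ):ℚ) = a' by push_cast; field_simp]
    exact Int.fract_intCast a'
end

section
/- Let S = S(h, a/b, Δ, τ, m) satisfy m ≥ w and m > bb't/h, be canonically defined and collision-free, and suppose r ≥ ℓ, where r is the number of right generators and ℓ the number of left generators of S. Then the Wilf number satisfies W ≥ 0. -/
open scoped Classical

open Eliahou

namespace WilfAux

open Eliahou

lemma exists_shift (c μ s : ℤ) (hμ : 0 < μ) (hs : s < c + μ) :
    ∃ j : ℕ, c ≤ s + j * μ ∧ s + j * μ < c + μ := by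
  refine ⟨((c + μ - 1 - s) / μ).toNat, ?_⟩
  have h0 : 0 ≤ (c + μ - 1 - s) / μ := Int.ediv_nonneg (by omega) hμ.le
  rw [Int.toNat_of_nonneg h0]
  have h1 := Int.mul_ediv_add_emod (c + μ - 1 - s) μ
  have h2 := Int.emod_nonneg (c + μ - 1 - s) hμ.ne'
  have h3 := Int.emod_lt_of_pos (c + μ - 1 - s) hμ
  constructor <;> nlinarith

lemma factor (S : AddSubmonoid ℤ) (hpos : ∀ x ∈ S, 0 ≤ x) :
    ∀ n : ℕ, (n : ℤ) ∈ S →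
      ∃ M : Multiset ℤ, (∀ g ∈ M, IsPrimitive (S : Set ℤ) g) ∧ M.sum = n := by
  intro n
  induction n using Nat.strong_induction_on with
  | _ n ih =>
    intro hn
    by_cases h0 : n = 0
    · exact ⟨0, by simp, by simp [h0]⟩
    by_cases hp : IsPrimitive (S : Set ℤ) n
    · exact ⟨{(n : ℤ)}, by simpa using hp, by simp⟩
    · have : ∃ u v : ℤ, u ∈ (S : Set ℤ) ∧ v ∈ (S : Set ℤ) ∧ u ≠ 0 ∧ v ≠ 0 ∧ u < n ∧ v < n ∧
          u + v = n := by
        by_contra hc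
        exact hp ⟨hn, by exact_mod_cast h0, hc⟩
      obtain ⟨u, v, hu, hv, hu0, hv0, hun, hvn, huv⟩ := this
      have hu' := hpos u hu
      have hv' := hpos v hv
      lift u to ℕ using hu'
      lift v to ℕ using hv'
      obtain ⟨M, hM, hMs⟩ := ih u (by exact_mod_cast hun) hu
      obtain ⟨N, hN, hNs⟩ := ih v (by exact_mod_cast hvn) hv
      refine ⟨M + N, ?_, by simp [hMs, hNs, huv]⟩
      intro g hg
      rcases Multiset.mem_add.1 hg with h | h
      · exact hM g h
      · exact hN g h

lemma sum_mem (S : AddSubmonoid ℤ) (M : Multiset ℤ)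
    (hM : ∀ g ∈ M, IsPrimitive (S : Set ℤ) g) : M.sum ∈ S :=
  AddSubmonoid.multiset_sum_mem S M (fun g hg => (hM g hg).1)

lemma decomp (M : Multiset ℤ) (v μ : ℤ) (hvμ : v ≠ μ) :
    M = M.filter (fun g => g ≠ v ∧ g ≠ μ) + Multiset.replicate (M.count v) v
      + Multiset.replicate (M.count μ) μ := by
  ext g
  simp only [Multiset.count_add, Multiset.count_filter, Multiset.count_replicate]
  by_cases h1 : g = v
  · subst h1
    simp [hvμ.symm]
  · by_cases h2 : g = μ
    · subst h2
      simp [hvμ]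
    · simp [h1, h2, Ne.symm h1, Ne.symm h2]

/-- unique factorization below `c + μ`. -/
lemma uniq (S : AddSubmonoid ℤ) (c μ : ℤ) (hμ : 0 < μ)
    (hμp : IsPrimitive (S : Set ℤ) μ)
    (hcf : IsCollisionFree (S : Set ℤ) c μ) (M N : Multiset ℤ)
    (hM : ∀ g ∈ M, IsPrimitive (S : Set ℤ) g) (hN : ∀ g ∈ N, IsPrimitive (S : Set ℤ) g)
    (hs : M.sum = N.sum) (hlt : M.sum < c + μ) : M = N := by
  obtain ⟨j, hj1, hj2⟩ := exists_shift c μ M.sum hμ hlt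
  have key : ∀ P : Multiset ℤ, (∀ g ∈ P, IsPrimitive (S : Set ℤ) g) →
      ∀ g ∈ P + Multiset.replicate j μ, IsPrimitive (S : Set ℤ) g := by
    intro P hP g hg
    rcases Multiset.mem_add.1 hg with h | h
    · exact hP g h
    · rw [Multiset.eq_of_mem_replicate h]; exact hμp
  have e1 : (M + Multiset.replicate j μ).sum = M.sum + j * μ := by simp
  have e2 : (N + Multiset.replicate j μ).sum = M.sum + j * μ := by simp [hs]
  have := hcf (M.sum + j * μ) (by rw [← e1]; exact sum_mem S _ (key M hM)) hj1 hj2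
    _ _ (key M hM) (key N hN) e1 e2
  exact add_right_cancel this

lemma claim_mu (S : AddSubmonoid ℤ) (hpos : ∀ x ∈ S, 0 ≤ x) (c μ : ℤ) (hμ : 0 < μ)
    (K D : Finset ℤ) (hK : ∀ z, z ∈ K ↔ z ∈ S ∧ z < c)
    (hD : ∀ x ∈ D, c ≤ x ∧ x < c + μ)
    (F : ℤ → Multiset ℤ)
    (hF : ∀ x ∈ D, (∀ g ∈ F x, IsPrimitive (S : Set ℤ) g) ∧ (F x).sum = x) :
    ∑ x ∈ D, (F x).count μ ≤ K.card := by
  have : (D.sigma (fun x => Finset.range ((F x).count μ))).card ≤ K.card := by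
    refine Finset.card_le_card_of_injOn (fun p => p.1 - ((p.2 : ℤ) + 1) * μ) ?_ ?_
    · rintro ⟨x, i⟩ hp
      simp only [Finset.coe_sigma, Set.mem_sigma_iff, Finset.mem_coe, Finset.mem_range] at hp
      obtain ⟨hx, hi⟩ := hp
      simp only [Finset.mem_coe, hK]
      constructor
      · have hle : Multiset.replicate (i + 1) μ ≤ F x :=
          Multiset.le_count_iff_replicate_le.1 hi
        obtain ⟨u, hu⟩ := Multiset.le_iff_exists_add.1 hle
        have hus : u.sum = x - ((i : ℤ) + 1) * μ := by
          have := (hF x hx).2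
          rw [hu] at this
          simp only [Multiset.sum_add, Multiset.sum_replicate, nsmul_eq_mul] at this
          push_cast at this
          linarith
        rw [← hus]
        apply sum_mem
        intro g hg
        exact (hF x hx).1 g (by rw [hu]; exact Multiset.mem_add.2 (Or.inr hg))
      · have := (hD x hx).2
        have : 0 ≤ (i : ℤ) * μ := by positivity
        nlinarith
    · rintro ⟨x, i⟩ hp ⟨y, j⟩ hq heq
      simp only [Finset.coe_sigma, Set.mem_sigma_iff, Finset.mem_coe, Finset.mem_range] at hp hq
      simp only at heq
      have hx := hD x hp.1
      have hy := hD y hq.1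
      have hij : (i : ℤ) = j := by
        rcases lt_trichotomy (i : ℤ) j with h | h | h
        · nlinarith
        · exact h
        · nlinarith
      have : x = y := by rw [hij] at heq; linarith
      subst this
      have : i = j := by exact_mod_cast hij
      subst this
      rfl
  simpa using this

lemma claim_q (S : AddSubmonoid ℤ) (c μ : ℤ) (hμ : 0 < μ) (hc : 0 < c) (hμS : μ ∈ S)
    (K : Finset ℤ) (hK : ∀ z, z ∈ K ↔ z ∈ S ∧ z < c) : c ≤ μ * K.card := by
  have h1 := Int.mul_ediv_add_emod (c + μ - 1) μ
  have h2 := Int.emod_nonneg (c + μ - 1) hμ.ne'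
  have h3 := Int.emod_lt_of_pos (c + μ - 1) hμ
  have h0 : 0 ≤ (c + μ - 1) / μ := Int.ediv_nonneg (by omega) hμ.le
  have : (Finset.range ((c + μ - 1) / μ).toNat).card ≤ K.card := by
    refine Finset.card_le_card_of_injOn (fun i => (i : ℤ) * μ) ?_ ?_
    · intro i hi
      simp only [Finset.coe_range, Set.mem_Iio] at hi
      have hi' : (i : ℤ) + 1 ≤ (c + μ - 1) / μ := by omega
      simp only [Finset.mem_coe, hK]
      refine ⟨?_, by nlinarith⟩
      have := S.nsmul_mem hμS i
      simpa using this
    · intro i _ j _ hij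
      simp only at hij
      exact_mod_cast mul_right_cancel₀ hμ.ne' hij
  rw [Finset.card_range] at this
  have h4 : (c + μ - 1) / μ ≤ K.card := by omega
  nlinarith

set_option maxHeartbeats 2000000 in
lemma claim_v (S : AddSubmonoid ℤ) (hpos : ∀ x ∈ S, 0 ≤ x) (c μ : ℤ) (hμ : 0 < μ)
    (hμp : IsPrimitive (S : Set ℤ) μ)
    (hcf : IsCollisionFree (S : Set ℤ) c μ)
    (K D : Finset ℤ) (hK : ∀ z, z ∈ K ↔ z ∈ S ∧ z < c)
    (hD : ∀ x, x ∈ D ↔ (c ≤ x ∧ x < c + μ) ∧ ¬ IsPrimitive (S : Set ℤ) x)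
    (F : ℤ → Multiset ℤ)
    (hF : ∀ x ∈ D, (∀ g ∈ F x, IsPrimitive (S : Set ℤ) g) ∧ (F x).sum = x)
    (v : ℤ) (hv : IsPrimitive (S : Set ℤ) v) (hvc : v < c) (hμv : μ < v) :
    ∃ x₀ ∈ D, v * ((∑ x ∈ D, (F x).count v : ℕ) : ℤ) + c - (x₀ - c) ≤ 2 * μ * K.card ∧
      v ∈ F x₀ ∧ ∀ g ∈ F x₀, g = v ∨ g = μ := by
  have hv0 : 0 < v := by omega
  let β : Multiset ℤ → ℕ := fun R => ((c + μ - 1 - R.sum) / v).toNat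
  have hβ : ∀ R : Multiset ℤ, R.sum ≤ c + μ - 1 →
      R.sum + β R * v ≤ c + μ - 1 ∧ c + μ - 1 < R.sum + (β R + 1) * v := by
    intro R hR
    have h0 : 0 ≤ (c + μ - 1 - R.sum) / v := Int.ediv_nonneg (by omega) hv0.le
    have e : ((β R : ℕ) : ℤ) = (c + μ - 1 - R.sum) / v := Int.toNat_of_nonneg h0
    rw [e]
    have h1 := Int.mul_ediv_add_emod (c + μ - 1 - R.sum) v
    have h2 := Int.emod_nonneg (c + μ - 1 - R.sum) hv0.ne'
    have h3 := Int.emod_lt_of_pos (c + μ - 1 - R.sum) hv0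
    constructor <;> nlinarith
  have hβ0 := hβ 0 (by simp; omega)
  simp only [Multiset.sum_zero, zero_add] at hβ0
  have hB1 : 1 ≤ β 0 := by
    by_contra hlt
    have : β 0 = 0 := by omega
    rw [this] at hβ0
    push_cast at hβ0
    omega
  obtain ⟨e, he1, he2⟩ := exists_shift c μ (β 0 * v) hμ (by omega)
  set M₀ : Multiset ℤ := Multiset.replicate (β 0) v + Multiset.replicate e μ with hM₀
  set x₀ : ℤ := β 0 * v + e * μ with hx₀
  have hM₀mem : ∀ g ∈ M₀, g = v ∨ g = μ := by
    intro g hg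
    rcases Multiset.mem_add.1 hg with h | h
    · exact Or.inl (Multiset.eq_of_mem_replicate h)
    · exact Or.inr (Multiset.eq_of_mem_replicate h)
  have hM₀p : ∀ g ∈ M₀, IsPrimitive (S : Set ℤ) g := by
    intro g hg
    rcases hM₀mem g hg with h | h
    · rw [h]; exact hv
    · rw [h]; exact hμp
  have hvM₀ : v ∈ M₀ := by
    refine Multiset.mem_add.2 (Or.inl ?_)
    rw [Multiset.mem_replicate]
    exact ⟨by omega, rfl⟩
  have hM₀s : M₀.sum = x₀ := by simp [hM₀, hx₀]
  have hx₀D : x₀ ∈ D := by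
    rw [hD]
    refine ⟨⟨he1, he2⟩, ?_⟩
    intro hp
    have := uniq S c μ hμ hμp hcf M₀ {x₀} hM₀p (by simpa using hp) (by simp [hM₀s])
      (by rw [hM₀s]; exact he2)
    rw [this] at hvM₀
    have := Multiset.mem_singleton.1 hvM₀
    omega
  have hFx₀ : F x₀ = M₀ :=
    uniq S c μ hμ hμp hcf _ _ (hF _ hx₀D).1 hM₀p (by rw [(hF _ hx₀D).2, hM₀s])
      (by rw [(hF _ hx₀D).2]; exact he2)
  have hcount₀ : (F x₀).count v = β 0 := by
    rw [hFx₀, hM₀]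
    simp [Multiset.count_replicate, hμv.ne]
  refine ⟨x₀, hx₀D, ?_, by rw [hFx₀]; exact hvM₀, by rw [hFx₀]; exact hM₀mem⟩
  let R : ℤ → Multiset ℤ := fun x => (F x).filter (fun g => g ≠ v ∧ g ≠ μ)
  have hR₀ : R x₀ = 0 := by
    simp only [R]
    rw [Multiset.filter_eq_nil]
    intro g hg
    rw [hFx₀] at hg
    have := hM₀mem g hg
    tauto
  have hx : ∀ x ∈ D, x = (R x).sum + (F x).count v * v + (F x).count μ * μ := by
    intro x hx
    have h1 := (hF x hx).2
    rw [decomp (F x) v μ hμv.ne'] at h1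
    simp only [Multiset.sum_add, Multiset.sum_replicate, nsmul_eq_mul] at h1
    exact h1.symm
  have hRp : ∀ x ∈ D, ∀ g ∈ R x, IsPrimitive (S : Set ℤ) g := by
    intro x hx g hg
    exact (hF x hx).1 g (Multiset.mem_of_mem_filter hg)
  have hRs : ∀ x ∈ D, (R x).sum + (F x).count v * v ≤ c + μ - 1 := by
    intro x hxD
    have h1 := hx x hxD
    have h2 := ((hD x).1 hxD).1.2
    have : 0 ≤ ((F x).count μ : ℤ) * μ := by positivity
    omega
  have hRs' : ∀ x ∈ D, (R x).sum ≤ c + μ - 1 := by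
    intro x hxD
    have h1 := hRs x hxD
    have : 0 ≤ ((F x).count v : ℤ) * v := by positivity
    omega
  have hbB : ∀ x ∈ D, (F x).count v ≤ β (R x) := by
    intro x hxD
    have h1 := hRs x hxD
    have h2 := (hβ _ (hRs' x hxD)).2
    by_contra hlt
    have : ((β (R x) : ℤ) + 1) ≤ (F x).count v := by exact_mod_cast (not_le.1 hlt)
    nlinarith
  let N : ℤ → ℕ := fun x =>
    if x = x₀ then ((c + μ - 1) / μ).toNat else (((F x).count v * v) / μ).toNat
  let G : ℤ → ℕ → Multiset ℤ := fun x i =>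
    R x + Multiset.replicate (β (R x) - (F x).count v) v + Multiset.replicate i μ
  have hGp : ∀ x ∈ D, ∀ i, ∀ g ∈ G x i, IsPrimitive (S : Set ℤ) g := by
    intro x hxD i g hg
    rcases Multiset.mem_add.1 hg with h | h
    · rcases Multiset.mem_add.1 h with h | h
      · exact hRp x hxD g h
      · rw [Multiset.eq_of_mem_replicate h]; exact hv
    · rw [Multiset.eq_of_mem_replicate h]; exact hμp
  have hGs : ∀ x ∈ D, ∀ i, (G x i).sum = (R x).sum + (β (R x) - (F x).count v) * v + i * μ := by
    intro x hxD i
    simp only [G, Multiset.sum_add, Multiset.sum_replicate, nsmul_eq_mul]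
    rw [Nat.cast_sub (hbB x hxD)]
  have hGlt : ∀ x ∈ D, ∀ i < N x, (G x i).sum < c := by
    intro x hxD i hi
    rw [hGs x hxD i]
    by_cases hxx : x = x₀
    · subst hxx
      simp only [N, if_true] at hi
      have hi' : (i : ℤ) + 1 ≤ (c + μ - 1) / μ := by omega
      have h1 := Int.mul_ediv_add_emod (c + μ - 1) μ
      have h2 := Int.emod_nonneg (c + μ - 1) hμ.ne'
      rw [hR₀, hcount₀]
      simp only [Multiset.sum_zero, sub_self, zero_mul, zero_add]
      nlinarith
    · simp only [N, if_neg hxx] at hi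
      have hi' : (i : ℤ) + 1 ≤ ((F x).count v * v) / μ := by omega
      have h1 := Int.mul_ediv_add_emod ((F x).count v * v) μ
      have h2 := Int.emod_nonneg ((F x).count v * v) hμ.ne'
      have h3 := (hβ _ (hRs' x hxD)).1
      nlinarith
  have hcard : (D.sigma (fun x => Finset.range (N x))).card ≤ K.card := by
    refine Finset.card_le_card_of_injOn (fun p => (G p.1 p.2).sum) ?_ ?_
    · rintro ⟨x, i⟩ hp
      simp only [Finset.coe_sigma, Set.mem_sigma_iff, Finset.mem_coe, Finset.mem_range] at hp
      simp only [Finset.mem_coe, hK]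
      exact ⟨sum_mem S _ (hGp x hp.1 i), hGlt x hp.1 i hp.2⟩
    · rintro ⟨x, i⟩ hp ⟨y, j⟩ hq heq
      simp only [Finset.coe_sigma, Set.mem_sigma_iff, Finset.mem_coe, Finset.mem_range] at hp hq
      simp only at heq
      have hG : G x i = G y j := uniq S c μ hμ hμp hcf _ _ (hGp x hp.1 i) (hGp y hq.1 j) heq
        (by have := hGlt x hp.1 i hp.2; omega)
      have hfilt : ∀ z k, (G z k).filter (fun g => g ≠ v ∧ g ≠ μ) = R z := by
        intro z k
        ext g
        simp only [G, R, Multiset.count_filter, Multiset.count_add, Multiset.count_replicate]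
        by_cases h1 : g = v
        · simp [h1]
        · by_cases h2 : g = μ
          · simp [h2]
          · simp [h1, h2, Ne.symm h1, Ne.symm h2]
      have hcv : ∀ z k, (G z k).count v = β (R z) - (F z).count v := by
        intro z k
        simp only [G, R, Multiset.count_filter, Multiset.count_add, Multiset.count_replicate]
        simp [hμv.ne]
      have hcm : ∀ z k, (G z k).count μ = k := by
        intro z k
        simp only [G, R, Multiset.count_filter, Multiset.count_add, Multiset.count_replicate]
        simp [hμv.ne']
      have hRR : R x = R y := by rw [← hfilt x i, ← hfilt y j, hG]
      have hij : i = j := by rw [← hcm x i, ← hcm y j, hG]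
      have hbb : (F x).count v = (F y).count v := by
        have h1 := hcv x i
        have h2 := hcv y j
        rw [hG, h2, hRR] at h1
        have h3 := hbB x hp.1
        have h4 := hbB y hq.1
        rw [hRR] at h3
        omega
      have hxy : x = y := by
        have h1 := hx x hp.1
        have h2 := hx y hq.1
        rw [hRR, hbb] at h1
        have h3 := ((hD x).1 hp.1).1
        have h4 := ((hD y).1 hq.1).1
        rcases lt_trichotomy ((F x).count μ : ℤ) ((F y).count μ) with h | h | h
        · nlinarith
        · rw [h] at h1; omega
        · nlinarith
      subst hxy
      subst hij
      rfl
  rw [Finset.card_sigma] at hcard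
  simp only [Finset.card_range] at hcard
  have hN : ∀ x ∈ D, v * ((F x).count v : ℤ) + (if x = x₀ then c - (x₀ - c) else 0)
      ≤ 2 * μ * (N x : ℤ) := by
    intro x hxD
    by_cases hxx : x = x₀
    · subst hxx
      simp only [N, if_true]
      have h0 : 0 ≤ (c + μ - 1) / μ := Int.ediv_nonneg (by omega) hμ.le
      rw [Int.toNat_of_nonneg h0, hcount₀]
      have h1 := Int.mul_ediv_add_emod (c + μ - 1) μ
      have h3 := Int.emod_lt_of_pos (c + μ - 1) hμ
      have : 0 ≤ (e : ℤ) * μ := by positivity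
      nlinarith
    · simp only [N, if_neg hxx]
      have hnn : 0 ≤ ((F x).count v : ℤ) * v := by positivity
      have h0 : 0 ≤ (((F x).count v : ℤ) * v) / μ := Int.ediv_nonneg hnn hμ.le
      rw [Int.toNat_of_nonneg h0]
      have h1 := Int.mul_ediv_add_emod (((F x).count v : ℤ) * v) μ
      have h3 := Int.emod_lt_of_pos (((F x).count v : ℤ) * v) hμ
      rcases Nat.eq_zero_or_pos ((F x).count v) with hz | hz
      · simp [hz]
      · have h5 : (1 : ℤ) ≤ (F x).count v := by exact_mod_cast hz
        have h6 : 1 ≤ (((F x).count v : ℤ) * v) / μ := by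
          rw [Int.le_ediv_iff_mul_le hμ]
          nlinarith
        nlinarith
  have hsum := Finset.sum_le_sum hN
  rw [Finset.sum_add_distrib, Finset.sum_ite_eq' D x₀, if_pos hx₀D, ← Finset.mul_sum,
    ← Finset.mul_sum] at hsum
  have hcard' : (∑ x ∈ D, (N x : ℤ)) ≤ K.card := by exact_mod_cast hcard
  push_cast
  nlinarith

lemma main (S : AddSubmonoid ℤ) (c m : ℤ) (hc : 0 < c) (hpos : ∀ x ∈ S, 0 ≤ x)
    (hIci : ∀ x, c ≤ x → x ∈ S) (hmS : m ∈ S) (hm0 : m ≠ 0)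
    (hcf : IsCollisionFree (S : Set ℤ) c m)
    (hr : nLeftGen (S : Set ℤ) c ≤ nRightGen (S : Set ℤ) c m) :
    0 ≤ WilfNum (S : Set ℤ) c m := by
  -- multiplicity
  have hmpos : 0 < m := lt_of_le_of_ne (hpos m hmS) hm0.symm
  have hex : ∃ n : ℕ, 0 < n ∧ (n : ℤ) ∈ S := ⟨m.toNat, by omega, by
    rw [Int.toNat_of_nonneg hmpos.le]; exact hmS⟩
  obtain ⟨μ, hμ, hμS, hμmin⟩ : ∃ μ : ℤ, 0 < μ ∧ μ ∈ S ∧ ∀ x ∈ S, x ≠ 0 → μ ≤ x := by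
    refine ⟨(Nat.find hex : ℤ), by exact_mod_cast (Nat.find_spec hex).1, (Nat.find_spec hex).2, ?_⟩
    intro x hx hx0
    have h0 := hpos x hx
    have := Nat.find_min' hex (m := x.toNat) ⟨by omega, by
      rw [Int.toNat_of_nonneg h0]; exact hx⟩
    omega
  have hμp : IsPrimitive (S : Set ℤ) μ := by
    refine ⟨hμS, hμ.ne', ?_⟩
    rintro ⟨u, v, hu, hv, hu0, hv0, hul, hvl, _⟩
    have := hμmin u hu hu0
    omega
  have hμm : μ ≤ m := hμmin m hmS hm0
  have hcf' : IsCollisionFree (S : Set ℤ) c μ := fun x hx h1 h2 => hcf x hx h1 (by omega)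
  have hprimle : ∀ x, IsPrimitive (S : Set ℤ) x → μ ≤ x := fun x hx => hμmin x hx.1 hx.2.1
  have hprimlt : ∀ x, IsPrimitive (S : Set ℤ) x → x < c + μ := by
    intro x hx
    by_contra hge
    refine hx.2.2 ⟨μ, x - μ, hμS, hIci _ (by omega), hμ.ne', by omega, by omega, by omega, by omega⟩
  set K : Finset ℤ := (Finset.Ico 0 c).filter (fun z => z ∈ S) with hKdef
  set L : Finset ℤ := (Finset.Ico 0 c).filter (fun z => IsPrimitive (S : Set ℤ) z) with hLdef
  set D : Finset ℤ := (Finset.Ico c (c + μ)).filter (fun z => ¬ IsPrimitive (S : Set ℤ) z) with hDdef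
  set Q : Finset ℤ := (Finset.Ico c (c + μ)).filter (fun z => IsPrimitive (S : Set ℤ) z) with hQdef
  have hK : ∀ z, z ∈ K ↔ z ∈ S ∧ z < c := by
    intro z
    simp only [hKdef, Finset.mem_filter, Finset.mem_Ico]
    exact ⟨fun h => ⟨h.2, h.1.2⟩, fun h => ⟨⟨hpos z h.1, h.2⟩, h.1⟩⟩
  have hL : ∀ z, z ∈ L ↔ IsPrimitive (S : Set ℤ) z ∧ z < c := by
    intro z
    simp only [hLdef, Finset.mem_filter, Finset.mem_Ico]
    exact ⟨fun h => ⟨h.2, h.1.2⟩, fun h => ⟨⟨hpos z h.1.1, h.2⟩, h.1⟩⟩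
  have hD : ∀ x, x ∈ D ↔ (c ≤ x ∧ x < c + μ) ∧ ¬ IsPrimitive (S : Set ℤ) x := by
    intro z
    simp only [hDdef, Finset.mem_filter, Finset.mem_Ico]
  have hk : rank (S : Set ℤ) c = K.card := by
    rw [rank, ← Set.ncard_coe_finset]
    congr 1
    ext z
    simp [hK]
  have hl : nLeftGen (S : Set ℤ) c = L.card := by
    rw [nLeftGen, ← Set.ncard_coe_finset]
    congr 1
    ext z
    simp [hL]
  have hrr : nRightGen (S : Set ℤ) c m = Q.card := by
    rw [nRightGen, ← Set.ncard_coe_finset]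
    congr 1
    ext z
    simp only [hQdef, Set.mem_setOf_eq, Finset.mem_coe, Finset.mem_filter, Finset.mem_Ico]
    constructor
    · rintro ⟨h1, h2, h3⟩
      exact ⟨⟨h2, hprimlt z h1⟩, h1⟩
    · rintro ⟨⟨h2, h3⟩, h1⟩
      exact ⟨h1, h2, by omega⟩
  have hμcard : (Q.card : ℤ) + D.card = μ := by
    have := Finset.card_filter_add_card_filter_not (s := Finset.Ico c (c + μ))
      (fun z => IsPrimitive (S : Set ℤ) z)
    rw [Int.card_Ico] at this
    have h2 : Q.card + D.card = (c + μ - c).toNat := this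
    omega
  have hfac : ∀ x : ℤ, ∃ M : Multiset ℤ, x ∈ S →
      (∀ g ∈ M, IsPrimitive (S : Set ℤ) g) ∧ M.sum = x := by
    intro x
    by_cases hx : x ∈ S
    · have h0 := hpos x hx
      lift x to ℕ using h0
      obtain ⟨M, hM⟩ := factor S hpos x hx
      exact ⟨M, fun _ => hM⟩
    · exact ⟨0, fun h => absurd h hx⟩
  choose F hF0 using hfac
  have hF : ∀ x ∈ D, (∀ g ∈ F x, IsPrimitive (S : Set ℤ) g) ∧ (F x).sum = x :=
    fun x hx => hF0 x (hIci x ((hD x).1 hx).1.1)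
  have hFL : ∀ x ∈ D, ∀ g ∈ F x, g ∈ L := by
    intro x hx g hg
    obtain ⟨u, hu⟩ := Multiset.exists_cons_of_mem hg
    have hgp := (hF x hx).1 g hg
    have hus : g + u.sum = x := by
      have := (hF x hx).2
      rw [hu, Multiset.sum_cons] at this
      exact this
    have huS : u.sum ∈ S := sum_mem S u (fun y hy => (hF x hx).1 y (by
      rw [hu]; exact Multiset.mem_cons_of_mem hy))
    have hu0 : u.sum ≠ 0 := by
      intro h0
      have : g = x := by omega
      rw [this] at hgp
      exact ((hD x).1 hx).2 hgp
    have h1 := hμmin _ huS hu0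
    have h2 := ((hD x).1 hx).1
    exact (hL g).2 ⟨hgp, by omega⟩
  have hq := claim_q S c μ hμ hc hμS K hK
  have hcm := claim_mu S hpos c μ hμ K D hK (fun x hx => ((hD x).1 hx).1) F hF
  have hcv : ∀ v : ℤ, ∃ x₀ : ℤ, v ∈ L.erase μ →
      x₀ ∈ D ∧ v * ((∑ x ∈ D, (F x).count v : ℕ) : ℤ) + c - (x₀ - c) ≤ 2 * μ * K.card ∧
      v ∈ F x₀ ∧ ∀ g ∈ F x₀, g = v ∨ g = μ := by
    intro v
    by_cases hvL : v ∈ L.erase μ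
    · rw [Finset.mem_erase, hL] at hvL
      obtain ⟨x₀, h1, h2⟩ := claim_v S hpos c μ hμ hμp hcf' K D hK hD F hF v hvL.2.1 hvL.2.2
        (lt_of_le_of_ne (hprimle v hvL.2.1) hvL.1.symm)
      exact ⟨x₀, fun _ => ⟨h1, h2⟩⟩
    · exact ⟨0, fun h => absurd h hvL⟩
  choose X hX using hcv
  have hXinj : Set.InjOn X (L.erase μ : Finset ℤ) := by
    intro v hv w hw hvw
    have h1 := (hX v hv).2.2.1
    rw [hvw] at h1
    rcases (hX w hw).2.2.2 v h1 with h | h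
    · exact h
    · exact absurd h (Finset.ne_of_mem_erase hv)
  have hexc : ∑ v ∈ L.erase μ, (X v - c) ≤ ∑ x ∈ D, (x - c) := by
    rw [← Finset.sum_image (f := fun x => x - c) hXinj]
    refine Finset.sum_le_sum_of_subset_of_nonneg ?_ ?_
    · intro x hx
      obtain ⟨v, hv, rfl⟩ := Finset.mem_image.1 hx
      exact (hX v hv).1
    · intro x hx _
      have := ((hD x).1 hx).1.1
      omega
  let A : ℤ → ℤ := fun v => v * ((∑ x ∈ D, (F x).count v : ℕ) : ℤ)
  have hA : ∑ v ∈ L, A v = ∑ x ∈ D, x := by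
    simp only [A]
    push_cast
    simp only [Finset.mul_sum]
    rw [Finset.sum_comm]
    refine Finset.sum_congr rfl ?_
    intro x hx
    conv_rhs => rw [← (hF x hx).2]
    rw [Finset.sum_multiset_count_of_subset (F x) L (by
      intro g hg; exact hFL x hx g (Multiset.mem_toFinset.1 hg))]
    refine Finset.sum_congr rfl ?_
    intro v _
    simp [mul_comm]
  have hmuA : A μ + c ≤ 2 * μ * K.card := by
    have : ((∑ x ∈ D, (F x).count μ : ℕ) : ℤ) ≤ K.card := by exact_mod_cast hcm
    simp only [A]
    nlinarith
  have herase : ∑ v ∈ L.erase μ, (A v + c) ≤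
      ∑ v ∈ L.erase μ, (2 * μ * K.card) + ∑ v ∈ L.erase μ, (X v - c) := by
    rw [← Finset.sum_add_distrib]
    refine Finset.sum_le_sum ?_
    intro v hv
    have := (hX v hv).2.1
    simp only [A]
    omega
  have hfull : ∑ v ∈ L, (A v + c) ≤ ∑ v ∈ L, (2 * μ * (K.card : ℤ)) + ∑ v ∈ L.erase μ, (X v - c) := by
    by_cases hμL : μ ∈ L
    · rw [← Finset.add_sum_erase L _ hμL, ← Finset.add_sum_erase L (fun _ => 2 * μ * (K.card : ℤ)) hμL]
      linarith
    · rw [Finset.erase_eq_of_notMem hμL] at herase ⊢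
      exact herase
  rw [Finset.sum_add_distrib, hA] at hfull
  rw [Finset.sum_sub_distrib (s := D)] at hexc
  simp only [Finset.sum_const, nsmul_eq_mul] at hfull hexc
  have hfin : (D.card : ℤ) * c + L.card * c ≤ L.card * (2 * μ * K.card) := by linarith
  rw [hl, hrr] at hr
  have hr' : (0 : ℤ) ≤ (Q.card : ℤ) - L.card := by
    have : (L.card : ℤ) ≤ Q.card := by exact_mod_cast hr
    linarith
  rw [WilfNum, hk, hl, hrr]
  have h1 := mul_nonneg hr' (sub_nonneg.2 hq)
  have h2 : 0 ≤ μ * ((K.card : ℤ) * (L.card + Q.card) - c) := by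
    have : c * μ = c * Q.card + c * D.card := by rw [← hμcard]; ring
    nlinarith
  exact nonneg_of_mul_nonneg_right h2 hμ

end WilfAux

/-- **Lemma W.** If `S = S(h, a/b, Δ, τ, m)` (with `m ≥ w` and
`m > bb't/h`) is canonically defined, collision-free and satisfies `r ≥ ℓ`,
then `W ≥ 0`. -/
theorem wilf_nonneg_of_many_right_gens (h : ℕ) (hh : 2 ≤ h) (a b a' b' : ℤ)
    (hF : IsFareyPred h a b a' b') (Δ : Finset ℕ) (hΔ : Δ.Nonempty) (τ m : ℤ)
    (hreg : Sw h a b τ m Δ ≤ m)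
    (hint : (b : ℚ) * (b' : ℚ) * St h a b τ m / (h : ℚ) < (m : ℚ))
    (hcan : IsCanonical h a b τ m Δ)
    (hcf : IsCollisionFree (Sset h a b τ m Δ) (Sc h a b τ m) m)
    (hr : nLeftGen (Sset h a b τ m Δ) (Sc h a b τ m)
      ≤ nRightGen (Sset h a b τ m Δ) (Sc h a b τ m) m) :
    0 ≤ WilfNum (Sset h a b τ m Δ) (Sc h a b τ m) m := by
  have hIci : ∀ x, Sc h a b τ m ≤ x → x ∈ Sset h a b τ m Δ := fun x hx =>
    AddSubmonoid.subset_closure (Or.inr hx)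
  obtain ⟨hm, -, hc1⟩ := hcan
  rcases le_or_gt (Sc h a b τ m) 0 with hc | hc
  · unfold WilfNum
    have : (0 : ℤ) ≤ (rank (Sset h a b τ m Δ) (Sc h a b τ m) : ℤ) *
      ((nLeftGen (Sset h a b τ m Δ) (Sc h a b τ m) : ℤ) +
        (nRightGen (Sset h a b τ m Δ) (Sc h a b τ m) m : ℤ)) := by positivity
    linarith
  · refine WilfAux.main (AddSubmonoid.closure ({m} ∪ (Sgam h a b τ m Δ : Set ℤ) ∪
      Set.Ici (Sc h a b τ m))) (Sc h a b τ m) m hc ?_ hIci hm.1 hm.2.1 hcf hr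
    intro x hx
    by_contra hneg
    apply hc1
    have h2 := AddSubmonoid.nsmul_mem _ hx 1
    have h1 := hIci (Sc h a b τ m - 1 - x) (by omega)
    have := AddSubmonoid.add_mem _ hx h1
    have e : x + (Sc h a b τ m - 1 - x) = Sc h a b τ m - 1 := by ring
    rw [e] at this
    exact this
end

section
/- Let h ≥ 2 and b be integers with ⌈h/2⌉ < b ≤ h. Then the semigroup Ŝ(h, (2b−1)/b, {0,1}) has Eliahou number E = −C(b−1, 2) = −(b−1)(b−2)/2. -/
open scoped Classical

open Eliahou

/-- number of copies -/
def cntF (h b i : ℕ) : ℕ := 2 * (h - i) - 1 - (if b ≤ h - i then 1 else 0)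

structure PP (h b : ℕ) (s m g c : ℤ) : Prop where
  hb2 : 2 ≤ b
  hbh : b ≤ h
  h2b : (h : ℤ) + 2 ≤ 2 * b
  hs : s = 2 * (h : ℤ) + 2 - b
  hm : m = b * s - ((h : ℤ) + 1 - b)
  hg : g = 2 * m - s
  hc : c = h * g + 1 - m

namespace PP
variable {h b : ℕ} {s m g c : ℤ}

theorem s_ge (P : PP h b s m g c) : (h : ℤ) + 2 ≤ s := by
  have := P.hbh; have := P.hs; omega

theorem m_gt (P : PP h b s m g c) : s + h < m := by
  have h1 := P.hb2; have h2 := P.s_ge; have h3 := P.hm; have h4 := P.hbh; have h5 := P.hs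
  have : (2 : ℤ) ≤ b := by exact_mod_cast h1
  have h4' : (b : ℤ) ≤ h := by exact_mod_cast h4
  by_cases hb3 : (b : ℤ) = 2
  · have := P.h2b
    rw [hb3] at h3 h5
    omega
  · have h6 : (3 : ℤ) ≤ b := by omega
    nlinarith [mul_le_mul_of_nonneg_right h6 (by omega : (0 : ℤ) ≤ s)]

theorem two_m (P : PP h b s m g c) : h * s + h + 1 < 2 * m := by
  have h1 := P.hb2; have h2 := P.s_ge; have h3 := P.hm; have h4 := P.hbh; have h5 := P.hs
  have h6 := P.h2b
  have := mul_le_mul_of_nonneg_right h6 (by omega : (0 : ℤ) ≤ s)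
  nlinarith

theorem c_gt (P : PP h b s m g c) : g < c := by
  have h1 := P.hb2; have h2 := P.s_ge; have h3 := P.hc; have h4 := P.hbh; have h5 := P.hg
  have h7 := P.m_gt
  have : (2 : ℤ) ≤ h := by exact_mod_cast (h1.trans h4)
  nlinarith [mul_le_mul_of_nonneg_right this (by omega : (0 : ℤ) ≤ g)]

theorem big (P : PP h b s m g c) {i j : ℤ} (hi : (h : ℤ) + 1 ≤ i) (hj : j ≤ i) :
    c + m ≤ i * g - j := by
  have h2 := P.s_ge; have h3 := P.hc; have h5 := P.hg
  have h7 := P.m_gt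
  nlinarith [mul_le_mul_of_nonneg_right hi (by omega : (0 : ℤ) ≤ g - 1)]

theorem A (P : PP h b s m g c) {i j : ℕ} (hi : i ≤ h) (hj : j ≤ i) :
    c ≤ i * g - j + cntF h b i * m ∧ (i * g - j + cntF h b i * m : ℤ) < c + m := by
  obtain ⟨d, rfl⟩ := Nat.exists_eq_add_of_le hi
  have h2 := P.s_ge; have h3 := P.hc; have h5 := P.hg; have hm := P.hm
  have h7 := P.m_gt; have h8 := P.two_m; have h9 := P.h2b; have h10 := P.hs
  have e : i + d - i = d := by omega
  unfold cntF
  rw [e]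
  have hj' : (j : ℤ) ≤ i := by exact_mod_cast hj
  push_cast at *
  rcases Nat.eq_zero_or_pos d with rfl | hd
  · have : ¬ b ≤ 0 := by have := P.hb2; omega
    simp only [this, if_false]
    simp at *
    constructor <;> nlinarith
  · split_ifs with hbd
    · have e2 : ((2 * d - 1 - 1 : ℕ) : ℤ) = 2 * d - 2 := by omega
      rw [e2]
      have hbd' : (b : ℤ) ≤ d := by exact_mod_cast hbd
      have h11 := mul_le_mul_of_nonneg_right hbd' (by omega : (0 : ℤ) ≤ s)
      have h12 : 0 ≤ (i : ℤ) * s := by apply mul_nonneg <;> omega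
      constructor <;> nlinarith
    · have e2 : ((2 * d - 1 - 0 : ℕ) : ℤ) = 2 * d - 1 := by omega
      rw [e2]
      have hbd' : (d : ℤ) + 1 ≤ b := by exact_mod_cast (not_le.mp hbd)
      have hd' : (1 : ℤ) ≤ d := by exact_mod_cast hd
      have h11 := mul_le_mul_of_nonneg_right hbd' (by omega : (0 : ℤ) ≤ s)
      have h12 := mul_le_mul_of_nonneg_right hd' (by omega : (0 : ℤ) ≤ s)
      constructor <;> nlinarith

theorem small_mul {a s x : ℤ} (h : a * s = x) (h1 : -s < x) (h2 : x < s) : a = 0 := by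
  have hs : 0 < s := by omega
  by_contra hne
  rcases lt_or_gt_of_ne hne with h3 | h3
  · have : a ≤ -1 := by omega
    nlinarith
  · have : 1 ≤ a := by omega
    nlinarith

theorem B0 (P : PP h b s m g c) {i j i' j' : ℕ} (hi : i ≤ h) (hj : j ≤ i)
    (hi' : i' ≤ h) (hj' : j' ≤ i') (w : (i * s + j : ℤ) - (i' * s + j') = m) : False := by
  have h2 := P.s_ge; have hm := P.hm; have h10 := P.hs; have hbh := P.hbh
  have key : ((i : ℤ) - i' - b) * s = j' - j - (h + 1 - b) := by linarith
  have := small_mul key (by omega) (by omega)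
  rw [this] at key
  omega

theorem B (P : PP h b s m g c) {i j i' j' : ℕ} (hi : i ≤ h) (hj : j ≤ i)
    (hi' : i' ≤ h) (hj' : j' ≤ i') (w : m ∣ (i * g - j : ℤ) - (i' * g - j')) :
    i = i' ∧ j = j' := by
  have h2 := P.s_ge; have h8 := P.two_m; have hm := P.m_gt
  have hb1 : ∀ i j : ℕ, i ≤ h → j ≤ i → (0 : ℤ) ≤ i * s + j ∧ (i * s + j : ℤ) < 2 * m := by
    intro i j hi hj
    have hi' : (i : ℤ) ≤ h := by exact_mod_cast hi
    have := mul_le_mul_of_nonneg_right hi' (by omega : (0 : ℤ) ≤ s)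
    have h12 : 0 ≤ (i : ℤ) * s := by apply mul_nonneg <;> omega
    constructor <;> omega
  obtain ⟨a1, a2⟩ := hb1 i j hi hj
  obtain ⟨a3, a4⟩ := hb1 i' j' hi' hj'
  obtain ⟨k, hk⟩ := w
  have hk2 : (i * s + j : ℤ) - (i' * s + j') = (2 * (i - i') - k) * m := by
    rw [P.hg] at hk; linarith
  generalize (2 * ((i : ℤ) - i') - k) = q at hk2
  have q1 : q < 2 := by nlinarith
  have q2 : -2 < q := by nlinarith
  have : q = -1 ∨ q = 0 ∨ q = 1 := by omega
  rcases this with rfl | rfl | rfl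
  · exact (P.B0 hi' hj' hi hj (by linarith)).elim
  · have key : ((i : ℤ) - i') * s = j' - j := by linarith
    have := small_mul key (by omega) (by omega)
    rw [this] at key
    omega
  · exact (P.B0 hi hj hi' hj' (by linarith)).elim

end PP

/-- combos -/
def Comb (m g : ℤ) (x : ℤ) : Prop := ∃ i j t : ℕ, j ≤ i ∧ x = i * g - j + t * m

theorem Comb.add {m g x y : ℤ} (hx : Comb m g x) (hy : Comb m g y) : Comb m g (x + y) := by
  obtain ⟨i, j, t, hj, rfl⟩ := hx
  obtain ⟨i', j', t', hj', rfl⟩ := hy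
  exact ⟨i + i', j + j', t + t', by omega, by push_cast; ring⟩

namespace PP
variable {h b : ℕ} {s m g c : ℤ}

theorem comb_nonneg (P : PP h b s m g c) {x : ℤ} (hx : Comb m g x) : x = 0 ∨ m ≤ x := by
  obtain ⟨i, j, t, hj, rfl⟩ := hx
  have h2 := P.s_ge; have hm := P.m_gt; have hg := P.hg
  have hj' : (j : ℤ) ≤ i := by exact_mod_cast hj
  rcases Nat.eq_zero_or_pos i with rfl | hi
  · have : j = 0 := by omega
    subst this
    rcases Nat.eq_zero_or_pos t with rfl | ht
    · simp
    · right
      have : (1 : ℤ) ≤ t := by exact_mod_cast ht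
      push_cast; nlinarith
  · right
    have h1 : (1 : ℤ) ≤ i := by exact_mod_cast hi
    have h3 : 0 ≤ (t : ℤ) * m := by apply mul_nonneg <;> omega
    nlinarith [mul_le_mul_of_nonneg_right h1 (by omega : (0 : ℤ) ≤ g - 1)]

theorem mem_iff (P : PP h b s m g c) (x : ℤ) :
    x ∈ SgpSet m {g, g - 1} c ↔ c ≤ x ∨ Comb m g x := by
  have hcg := P.c_gt; have hm := P.m_gt; have h2 := P.s_ge; have hg := P.hg
  unfold SgpSet
  constructor
  · intro hx
    induction hx using AddSubmonoid.closure_induction with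
    | mem x hx =>
      simp only [Finset.coe_insert, Finset.coe_singleton, Set.mem_union, Set.mem_singleton_iff,
        Set.mem_insert_iff, Set.mem_Ici] at hx
      rcases hx with (rfl | rfl | rfl) | hx
      · right; exact ⟨0, 0, 1, by omega, by simp⟩
      · right; exact ⟨1, 0, 0, by omega, by simp⟩
      · right; exact ⟨1, 1, 0, by omega, by simp⟩
      · left; exact hx
    | zero => right; exact ⟨0, 0, 0, by omega, by simp⟩
    | add x y _ _ hx hy =>
      have hp : ∀ z, c ≤ z ∨ Comb m g z → 0 ≤ z := by
        rintro z (hz | hz)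
        · omega
        · rcases P.comb_nonneg hz with h | h <;> omega
      have p1 := hp x hx
      have p2 := hp y hy
      rcases hx with hx | hx
      · left; omega
      · rcases hy with hy | hy
        · left; omega
        · right; exact hx.add hy
  · have hmm : m ∈ AddSubmonoid.closure ({m} ∪ (({g, g - 1} : Finset ℤ) : Set ℤ) ∪ Set.Ici c) :=
      AddSubmonoid.subset_closure (by simp)
    have hgm : g ∈ AddSubmonoid.closure ({m} ∪ (({g, g - 1} : Finset ℤ) : Set ℤ) ∪ Set.Ici c) :=
      AddSubmonoid.subset_closure (by simp)
    have hg1 : g - 1 ∈ AddSubmonoid.closure ({m} ∪ (({g, g - 1} : Finset ℤ) : Set ℤ) ∪ Set.Ici c) :=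
      AddSubmonoid.subset_closure (by simp)
    rintro (hx | ⟨i, j, t, hj, rfl⟩)
    · exact AddSubmonoid.subset_closure (by simp [hx])
    · obtain ⟨l, rfl⟩ := Nat.exists_eq_add_of_le hj
      have := add_mem (add_mem (nsmul_mem hgm l) (nsmul_mem hg1 j)) (nsmul_mem hmm t)
      simp only [nsmul_eq_mul] at this
      have e : (((j + l : ℕ) : ℤ) * g - j + t * m : ℤ) = l * g + j * (g - 1) + t * m := by
        push_cast; ring
      rw [e]
      exact this

/-- A combination below c + m has i ≤ h, and t below / equal the count. -/
theorem comb_lt (P : PP h b s m g c) {i j t : ℕ} (hj : j ≤ i)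
    (hx : (i * g - j + t * m : ℤ) < c + m) : i ≤ h := by
  by_contra hi
  have := P.big (i := i) (j := j) (by omega) (by omega)
  have hm := P.m_gt; have h2 := P.s_ge
  have h3 : 0 ≤ (t : ℤ) * m := by apply mul_nonneg <;> omega
  omega

theorem t_lt (P : PP h b s m g c) {i j t : ℕ} (hi : i ≤ h) (hj : j ≤ i) :
    (i * g - j + t * m : ℤ) < c ↔ t < cntF h b i := by
  obtain ⟨a1, a2⟩ := P.A hi hj
  have hm := P.m_gt; have h2 := P.s_ge
  constructor
  · intro hx
    by_contra hne
    have : (cntF h b i : ℤ) ≤ t := by exact_mod_cast (not_lt.mp hne)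
    nlinarith
  · intro hx
    have : (t : ℤ) + 1 ≤ cntF h b i := by exact_mod_cast hx
    nlinarith

theorem t_eq (P : PP h b s m g c) {i j t : ℕ} (hi : i ≤ h) (hj : j ≤ i)
    (h1 : c ≤ (i * g - j + t * m : ℤ)) (h2 : (i * g - j + t * m : ℤ) < c + m) :
    t = cntF h b i := by
  have := (P.t_lt (t := t) hi hj).not.mp (by omega)
  rcases (not_lt.mp this).eq_or_lt with h3 | h3
  · exact h3.symm
  · obtain ⟨a1, a2⟩ := P.A hi hj
    have hm := P.m_gt; have h2 := P.s_ge
    have : (cntF h b i : ℤ) + 1 ≤ t := by exact_mod_cast h3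
    nlinarith

theorem rank_eq (P : PP h b s m g c) :
    rank (SgpSet m {g, g - 1} c) c = ∑ i ∈ Finset.range (h + 1), (i + 1) * cntF h b i := by
  have hm := P.m_gt; have h2 := P.s_ge
  let F : (Σ _ : ℕ, ℕ × ℕ) → ℤ := fun p => p.1 * g - p.2.1 + p.2.2 * m
  let T : Finset (Σ _ : ℕ, ℕ × ℕ) := (Finset.range (h + 1)).sigma
    fun i => Finset.range (i + 1) ×ˢ Finset.range (cntF h b i)
  have hT : SgpSet m {g, g - 1} c ∩ Set.Iio c = ((T.image F : Finset ℤ) : Set ℤ) := by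
    ext x
    simp only [Set.mem_inter_iff, P.mem_iff, Set.mem_Iio, Finset.coe_image, Set.mem_image,
      Finset.mem_coe, T, F, Finset.mem_sigma, Finset.mem_product, Finset.mem_range, Sigma.exists,
      Prod.exists]
    constructor
    · rintro ⟨hx | ⟨i, j, t, hj, rfl⟩, hlt⟩
      · omega
      · have hi := P.comb_lt (t := t) hj (by omega)
        exact ⟨i, j, t, ⟨by omega, by omega, (P.t_lt hi hj).mp hlt⟩, rfl⟩
    · rintro ⟨i, j, t, ⟨hi, hj, ht⟩, rfl⟩
      exact ⟨Or.inr ⟨i, j, t, by omega, rfl⟩, (P.t_lt (by omega) (by omega)).mpr ht⟩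
  unfold rank
  rw [hT, Set.ncard_coe_finset, Finset.card_image_of_injOn]
  · simp [T, Finset.card_sigma]
  · rintro ⟨i, j, t⟩ hp ⟨i', j', t'⟩ hp' heq
    simp only [T, F, Finset.coe_sigma, Set.mem_sigma_iff, Finset.mem_coe, Finset.mem_range,
      Finset.mem_product] at hp hp' heq
    obtain ⟨rfl, rfl⟩ := P.B (i := i) (j := j) (i' := i') (j' := j') (by omega) (by omega)
      (by omega) (by omega) ⟨t' - t, by linarith⟩
    have : (t : ℤ) = t' := by
      have h4 : (t : ℤ) * m = t' * m := by linarith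
      exact mul_right_cancel₀ (by omega) h4
    simp only [Nat.cast_inj] at this
    rw [this]

theorem mem_pos (P : PP h b s m g c) {x : ℤ} (hx : x ∈ SgpSet m {g, g - 1} c) (h0 : x ≠ 0) :
    m ≤ x := by
  rcases (P.mem_iff x).mp hx with h | h
  · have := P.c_gt; have := P.hg; have := P.m_gt; have := P.s_ge
    omega
  · exact (P.comb_nonneg h).resolve_left h0

theorem left_eq (P : PP h b s m g c) : nLeftGen (SgpSet m {g, g - 1} c) c = 3 := by
  have hm := P.m_gt; have h2 := P.s_ge; have hg := P.hg; have hcg := P.c_gt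
  have : {x : ℤ | IsPrimitive (SgpSet m {g, g - 1} c) x ∧ x < c} =
      (({m, g, g - 1} : Finset ℤ) : Set ℤ) := by
    ext x
    simp only [Set.mem_ofPred_eq, Finset.coe_insert, Finset.coe_singleton, Set.mem_insert_iff,
      Set.mem_singleton_iff]
    constructor
    · rintro ⟨⟨hx, h0, hn⟩, hlt⟩
      rcases (P.mem_iff x).mp hx with h | ⟨i, j, t, hj, rfl⟩
      · omega
      · by_contra hne
        apply hn
        -- split off a generator
        have aux : ∀ u v : ℤ, Comb m g u → Comb m g v → u ≠ 0 → v ≠ 0 →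
            u + v = (i * g - j + t * m : ℤ) → ∃ u v : ℤ, u ∈ SgpSet m {g, g - 1} c ∧
            v ∈ SgpSet m {g, g - 1} c ∧ u ≠ 0 ∧ v ≠ 0 ∧ u < (i * g - j + t * m : ℤ) ∧
            v < (i * g - j + t * m : ℤ) ∧ u + v = (i * g - j + t * m : ℤ) := by
          intro u v hu hv hu0 hv0 e
          have := (P.comb_nonneg hu).resolve_left hu0
          have := (P.comb_nonneg hv).resolve_left hv0
          exact ⟨u, v, (P.mem_iff u).mpr (Or.inr hu), (P.mem_iff v).mpr (Or.inr hv), hu0, hv0,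
            by omega, by omega, e⟩
        rcases Nat.eq_zero_or_pos t with rfl | ht
        · rcases Nat.eq_zero_or_pos i with rfl | hi
          · exfalso
            have : j = 0 := by omega
            subst this
            simp at h0
          · obtain ⟨i, rfl⟩ := Nat.exists_eq_add_of_le' hi
            rcases Nat.eq_zero_or_pos j with rfl | hj0
            · refine aux g (i * g) ⟨1, 0, 0, by omega, by simp⟩ ⟨i, 0, 0, by omega, by simp⟩
                (by omega) ?_ (by push_cast; ring)
              intro h
              apply hne
              right; left
              push_cast; linarith
            · obtain ⟨j, rfl⟩ := Nat.exists_eq_add_of_le' hj0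
              refine aux (g - 1) (i * g - j) ⟨1, 1, 0, by omega, by simp⟩
                ⟨i, j, 0, by omega, by simp⟩ (by omega) ?_ (by push_cast; ring)
              intro h
              apply hne
              right; right
              push_cast; linarith
        · obtain ⟨t, rfl⟩ := Nat.exists_eq_add_of_le' ht
          refine aux m (i * g - j + t * m) ⟨0, 0, 1, by omega, by simp⟩ ⟨i, j, t, hj, rfl⟩
            (by omega) ?_ (by push_cast; ring)
          intro h
          apply hne
          left
          push_cast; linarith
    · have hprim : ∀ x : ℤ, Comb m g x → m ≤ x → x < 2 * m →
          IsPrimitive (SgpSet m {g, g - 1} c) x := by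
        intro x hx h1 h3
        refine ⟨(P.mem_iff x).mpr (Or.inr hx), by omega, ?_⟩
        rintro ⟨u, v, hu, hv, hu0, hv0, -, -, e⟩
        have := P.mem_pos hu hu0
        have := P.mem_pos hv hv0
        omega
      rintro (rfl | rfl | rfl)
      · exact ⟨hprim _ ⟨0, 0, 1, by omega, by simp⟩ (by omega) (by omega), by omega⟩
      · exact ⟨hprim _ ⟨1, 0, 0, by omega, by simp⟩ (by omega) (by omega), by omega⟩
      · exact ⟨hprim _ ⟨1, 1, 0, by omega, by simp⟩ (by omega) (by omega), by omega⟩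
  unfold nLeftGen
  rw [this, Set.ncard_coe_finset, Finset.card_insert_of_notMem, Finset.card_pair (by omega)]
  · simp only [Finset.mem_insert, Finset.mem_singleton]
    have := P.hb2
    have := P.hbh
    omega

theorem right_eq (P : PP h b s m g c) :
    (nRightGen (SgpSet m {g, g - 1} c) c m : ℤ) =
      m - ((∑ i ∈ Finset.range (h + 1), (i + 1) : ℕ) : ℤ) := by
  have hm := P.m_gt; have h2 := P.s_ge; have hg := P.hg; have hcg := P.c_gt
  let F : (Σ _ : ℕ, ℕ) → ℤ := fun p => p.1 * g - p.2 + cntF h b p.1 * m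
  let T : Finset (Σ _ : ℕ, ℕ) := (Finset.range (h + 1)).sigma fun i => Finset.range (i + 1)
  have hsub : T.image F ⊆ Finset.Ico c (c + m) := by
    intro x hx
    simp only [T, F, Finset.mem_image, Finset.mem_sigma, Finset.mem_range, Sigma.exists] at hx
    obtain ⟨i, j, ⟨hi, hj⟩, rfl⟩ := hx
    rw [Finset.mem_Ico]
    exact P.A (by omega) (by omega)
  have hT : {x : ℤ | IsPrimitive (SgpSet m {g, g - 1} c) x ∧ c ≤ x ∧ x < c + m} =
      ((Finset.Ico c (c + m) \ T.image F : Finset ℤ) : Set ℤ) := by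
    ext x
    simp only [Set.mem_ofPred_eq, Finset.coe_sdiff, Set.mem_sdiff, Finset.mem_coe, Finset.mem_Ico,
      Finset.mem_image, T, F, Finset.mem_sigma, Finset.mem_range, Sigma.exists]
    constructor
    · rintro ⟨⟨hx, h0, hn⟩, h1, h3⟩
      refine ⟨⟨h1, h3⟩, ?_⟩
      rintro ⟨i, j, ⟨hi, hj⟩, rfl⟩
      apply hn
      have aux : ∀ u v : ℤ, Comb m g u → Comb m g v → u ≠ 0 → u < c →
            u + v = (i * g - j + cntF h b i * m : ℤ) → ∃ u v : ℤ, u ∈ SgpSet m {g, g - 1} c ∧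
            v ∈ SgpSet m {g, g - 1} c ∧ u ≠ 0 ∧ v ≠ 0 ∧ u < (i * g - j + cntF h b i * m : ℤ) ∧
            v < (i * g - j + cntF h b i * m : ℤ) ∧ u + v = (i * g - j + cntF h b i * m : ℤ) := by
          intro u v hu hv hu0 huc e
          have := (P.comb_nonneg hu).resolve_left hu0
          have hv0 : v ≠ 0 := by omega
          have := (P.comb_nonneg hv).resolve_left hv0
          exact ⟨u, v, (P.mem_iff u).mpr (Or.inr hu), (P.mem_iff v).mpr (Or.inr hv), hu0, hv0,
            by omega, by omega, e⟩
      rcases Nat.eq_zero_or_pos i with rfl | hi0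
      · have hj0 : j = 0 := by omega
        subst hj0
        rcases Nat.eq_zero_or_pos (cntF h b 0) with ht | ht
        · rw [ht] at h0; simp at h0
        · obtain ⟨t, ht⟩ := Nat.exists_eq_add_of_le' ht
          refine aux m (t * m) ⟨0, 0, 1, by omega, by simp⟩ ⟨0, 0, t, by omega, by simp⟩
            (by omega) (by omega) (by rw [ht]; push_cast; ring)
      · obtain ⟨i, rfl⟩ := Nat.exists_eq_add_of_le' hi0
        rcases Nat.eq_zero_or_pos j with rfl | hj0
        · exact aux g (i * g - (0 : ℕ) + cntF h b (i + 1) * m) ⟨1, 0, 0, by omega, by simp⟩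
            ⟨i, 0, _, by omega, rfl⟩ (by omega) (by omega) (by push_cast; ring)
        · obtain ⟨j, rfl⟩ := Nat.exists_eq_add_of_le' hj0
          exact aux (g - 1) (i * g - j + cntF h b (i + 1) * m) ⟨1, 1, 0, by omega, by simp⟩
            ⟨i, j, _, by omega, rfl⟩ (by omega) (by omega) (by push_cast; ring)
    · rintro ⟨⟨h1, h3⟩, hn⟩
      refine ⟨⟨(P.mem_iff x).mpr (Or.inl h1), by omega, ?_⟩, h1, h3⟩
      rintro ⟨u, v, hu, hv, hu0, hv0, -, -, e⟩
      have e1 := P.mem_pos hu hu0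
      have e2 := P.mem_pos hv hv0
      have hu' := ((P.mem_iff u).mp hu).resolve_left (by omega)
      have hv' := ((P.mem_iff v).mp hv).resolve_left (by omega)
      obtain ⟨i, j, t, hj, hx⟩ := hu'.add hv'
      rw [e] at hx
      subst hx
      have hi := P.comb_lt hj h3
      have := P.t_eq hi hj h1 h3
      subst this
      exact hn ⟨i, j, ⟨by omega, by omega⟩, rfl⟩
  have hcard : (T.image F).card = ∑ i ∈ Finset.range (h + 1), (i + 1) := by
    rw [Finset.card_image_of_injOn]
    · simp only [T, Finset.card_sigma, Finset.card_range]
    · rintro ⟨i, j⟩ hp ⟨i', j'⟩ hp' heq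
      simp only [T, F, Finset.coe_sigma, Set.mem_sigma_iff, Finset.mem_coe, Finset.mem_range]
        at hp hp' heq
      obtain ⟨rfl, rfl⟩ := P.B (i := i) (j := j) (i' := i') (j' := j') (by omega) (by omega)
        (by omega) (by omega) ⟨cntF h b i' - cntF h b i, by linarith⟩
      rfl
  have hle := Finset.card_le_card hsub
  unfold nRightGen
  rw [hT, Set.ncard_coe_finset, Finset.card_sdiff_of_subset hsub, Nat.cast_sub hle, hcard,
    Int.card_Ico]
  congr 1
  omega

theorem q_eq (P : PP h b s m g c) : qdepth c m = 2 * h - 2 := by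
  have hm := P.m_gt; have h2 := P.s_ge; have hbh := P.hbh; have hb2 := P.hb2
  obtain ⟨a1, a2⟩ := P.A (i := 0) (j := 0) (by omega) (by omega)
  have e : (cntF h b 0 : ℤ) = 2 * h - 2 := by
    unfold cntF
    simp [hbh]; omega
  rw [e] at a1 a2
  simp only [Nat.cast_zero] at a1 a2
  have hm0 : (0 : ℚ) < m := by exact_mod_cast (by omega : 0 < m)
  unfold qdepth
  rw [Int.ceil_eq_iff, lt_div_iff₀ hm0, div_le_iff₀ hm0]
  constructor
  · have : (2 * h - 2 - 1) * m < c := by linarith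
    exact_mod_cast this
  · have : c ≤ (2 * h - 2) * m := by linarith
    exact_mod_cast this

end PP

theorem sum_tri (h : ℕ) : 2 * ((∑ i ∈ Finset.range (h + 1), (i + 1) : ℕ) : ℤ)
    = (h + 1) * (h + 2) := by
  induction h with
  | zero => simp
  | succ n ih => rw [Finset.sum_range_succ]; push_cast at *; linarith

theorem sum_lt (h b : ℕ) (hbh : h < b) :
    6 * (∑ i ∈ Finset.range (h + 1), ((i : ℤ) + 1) * cntF h b i) = h * (h + 1) * (2 * h + 1) := by
  have e : ∀ i ∈ Finset.range (h + 1), ((i : ℤ) + 1) * cntF h b i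
      = (i + 1) * (2 * h - 2 * i - 1) + (if i = h then (h + 1 : ℤ) else 0) := by
    intro i hi
    rw [Finset.mem_range] at hi
    split_ifs with h1
    · subst h1; simp [cntF]
    · have : (cntF h b i : ℤ) = 2 * h - 2 * i - 1 := by
        unfold cntF; split_ifs <;> omega
      rw [this]; ring
  rw [Finset.sum_congr rfl e, Finset.sum_add_distrib]
  simp only [Finset.sum_ite_eq', Finset.mem_range, lt_add_iff_pos_right, zero_lt_one, if_true]
  have key : ∀ k : ℕ, 6 * ∑ i ∈ Finset.range k, ((i : ℤ) + 1) * (2 * h - 2 * i - 1)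
      = 3 * (2 * h - 1) * k * (k + 1) - 4 * (k - 1) * k * (k + 1) := by
    intro k
    induction k with
    | zero => simp
    | succ k ih => rw [Finset.sum_range_succ, mul_add, ih]; push_cast; ring
  rw [mul_add, key]; push_cast; ring

theorem sum_k (h b : ℕ) (hb : 2 ≤ b) (hbh : b ≤ h) :
    6 * (∑ i ∈ Finset.range (h + 1), ((i : ℤ) + 1) * cntF h b i) =
      h * (h + 1) * (2 * h + 1) - 3 * (h + 1 - b) * (h + 2 - b) := by
  have e : ∀ i ∈ Finset.range (h + 1), ((i : ℤ) + 1) * cntF h b i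
      = ((i : ℤ) + 1) * cntF h (h + 1) i - (if i < h - b + 1 then ((i + 1 : ℕ) : ℤ) else 0) := by
    intro i hi
    rw [Finset.mem_range] at hi
    have : (cntF h b i : ℤ) = cntF h (h + 1) i - (if i < h - b + 1 then 1 else 0) := by
      unfold cntF; split_ifs <;> omega
    rw [this]
    split_ifs <;> push_cast <;> ring
  rw [Finset.sum_congr rfl e, Finset.sum_sub_distrib, mul_sub, sum_lt h (h + 1) (by omega),
    ← Finset.sum_filter]
  have e2 : (Finset.range (h + 1)).filter (fun i => i < h - b + 1) = Finset.range (h - b + 1) := by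
    ext i; simp; omega
  rw [e2]
  have := sum_tri (h - b)
  rw [Nat.cast_sum] at this
  rw [Nat.cast_sub hbh] at this
  linarith

theorem PP.E_eq {h b : ℕ} {s m g c : ℤ} (P : PP h b s m g c) :
    2 * EliahouNum (SgpSet m {g, g - 1} c) c m = -((b - 1) * (b - 2)) := by
  unfold EliahouNum
  rw [P.rank_eq, P.left_eq, P.right_eq, P.q_eq]
  have h1 := sum_tri h
  have h2 := sum_k h b P.hb2 P.hbh
  push_cast at *
  set K := ∑ i ∈ Finset.range (h + 1), ((i : ℤ) + 1) * cntF h b i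
  set R := ∑ i ∈ Finset.range (h + 1), ((i : ℤ) + 1)
  have h3 : 2 * (K * 3 + (2 * h - 2) * (m - R) - c) =
    6 * K + (2 * h - 2) * (2 * m - 2 * R) - 2 * c := by ring
  rw [h3, h2, h1, P.hc, P.hg, P.hm, P.hs]
  ring

theorem floor_exact (x y : ℚ) (n : ℤ) (hxy : x - y = n) : ⌊x⌋ - ⌊y⌋ = n := by
  have : x = y + n := by linarith
  rw [this, Int.floor_add_intCast]; ring

/-- **Proposition ex2.** For `⌈h/2⌉ < b ≤ h`, the semigroup
`Ŝ(h, (2b−1)/b, {0,1})` (whose `h`-Farey predecessor is `(2b−3)/(b−1)`) has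
Eliahou number `E = −C(b−1, 2) = −(b−1)(b−2)/2`. -/
theorem family_2bm1_eliahou (h b : ℕ) (hh : 2 ≤ h)
    (hb : (h + 1) / 2 < b) (hbh : b ≤ h) :
    EliahouNum
        (Sset h (2 * (b : ℤ) - 1) (b : ℤ) (tauhat h (b : ℤ) {0, 1})
          (mhat h (b : ℤ) ((b : ℤ) - 1) {0, 1}) ({0, 1} : Finset ℕ))
        (Sc h (2 * (b : ℤ) - 1) (b : ℤ) (tauhat h (b : ℤ) {0, 1})
          (mhat h (b : ℤ) ((b : ℤ) - 1) {0, 1}))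
        (mhat h (b : ℤ) ((b : ℤ) - 1) {0, 1})
      = -((b - 1).choose 2 : ℤ) ∧
    ((b - 1).choose 2 : ℤ) = ((b : ℤ) - 1) * ((b : ℤ) - 2) / 2 := by
  have hb2 : 2 ≤ b := by omega
  have hbh' : (b : ℤ) ≤ h := by exact_mod_cast hbh
  have hd : delta1 ({0, 1} : Finset ℕ) = 1 := by decide
  have hchoose : 2 * ((b - 1).choose 2 : ℤ) = ((b : ℤ) - 1) * ((b : ℤ) - 2) := by
    obtain ⟨n, rfl⟩ := Nat.exists_eq_add_of_le' hb2
    have h1 : n + 2 - 1 = n + 1 := by omega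
    rw [h1]
    have h2 := Nat.triangle_succ n
    have h3 := Finset.sum_range_id_mul_two (n + 1)
    rw [Finset.sum_range_id, ← Nat.choose_two_right] at h3
    simp only [Nat.add_sub_cancel] at h3
    have h4 : (((n + 1).choose 2 : ℕ) : ℤ) * 2 = (n + 1) * n := by exact_mod_cast h3
    push_cast
    linarith
  refine ⟨?_, by omega⟩
  set m := mhat h (b : ℤ) ((b : ℤ) - 1) {0, 1} with hm
  set τ := tauhat h (b : ℤ) {0, 1} with hτ
  set c := Sc h (2 * (b : ℤ) - 1) (b : ℤ) τ m with hc
  have hm2 : m = b * (2 * (h : ℤ) + 2 - b) - ((h : ℤ) + 1 - b) := by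
    rw [hm]; unfold mhat; rw [hd]; push_cast; ring
  have hc2 : c = h * (2 * m - (2 * (h : ℤ) + 2 - b)) + 1 - m := by
    have hbq : (b : ℚ) ≠ 0 := by
      have : b ≠ 0 := by omega
      exact_mod_cast this
    have := floor_exact (((2 * (b : ℤ) - 1 : ℤ) : ℚ) * (h : ℚ) * (m : ℚ) / ((b : ℤ) : ℚ))
      (((h : ℚ) - ((b : ℤ) : ℚ)) * ((h : ℚ) * ((1 : ℕ) : ℚ) + 1) / ((b : ℤ) : ℚ))
      (h * (2 * m - (2 * (h : ℤ) + 2 - b)) + 1) (by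
        rw [hm2]; push_cast; field_simp; ring)
    rw [hc, hτ]
    unfold Sc tauhat
    rw [hd]
    linarith
  have hbase : Sbase h (2 * (b : ℤ) - 1) (b : ℤ) τ m = 2 * m - (2 * (h : ℤ) + 2 - b) := by
    unfold Sbase
    rw [← hc]
    have e : c + m - 1 = h * (2 * m - (2 * (h : ℤ) + 2 - b)) := by rw [hc2]; ring
    have hq : (h : ℚ) ≠ 0 := by
      have : h ≠ 0 := by omega
      exact_mod_cast this
    rw [e, Int.cast_mul, Int.cast_natCast, mul_div_cancel_left₀ _ hq, Int.floor_intCast]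
  have P : PP h b (2 * (h : ℤ) + 2 - b) m (2 * m - (2 * (h : ℤ) + 2 - b)) c :=
    ⟨hb2, hbh, by omega, rfl, hm2, rfl, hc2⟩
  have hS : Sset h (2 * (b : ℤ) - 1) (b : ℤ) τ m ({0, 1} : Finset ℕ) =
      SgpSet m {2 * m - (2 * (h : ℤ) + 2 - b), 2 * m - (2 * (h : ℤ) + 2 - b) - 1} c := by
    unfold Sset Sgam
    rw [hbase, ← hc]
    congr 1
    ext x
    simp
  rw [hS]
  have := P.E_eq
  omega
end
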